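/- arXiv:1705.08724 — 3 statements merged into one kernel-verified Lean document; each statement's English description precedes it below -/
import Mathlib

section
/- Let G be a minimum counterexample to Hajós' conjecture containing two adjacent vertices u and v, each of degree 6, with |N(u) ∩ N(v)| = 5. Then N(u) ∩ N(v) is an independent set in G (no two of its vertices are adjacent). -/
/-- A simple graph is Eulerian if it is connected and every vertex has even degree. -/
def IsEulerian {V : Type} [Fintype V] (G : SimpleGraph V) : Prop :=
  G.Connected ∧ ∀ v : V, Even ((G.neighborSet v).ncard)

/-- `G` fulfils Hajós' conjecture: its edge set can be partitioned into at most
`⌊(n-1)/2⌋` edge-disjoint cycles, where `n` is the number of vertices. -/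
def FulfilsHajos {V : Type} [Fintype V] (G : SimpleGraph V) : Prop :=
  ∃ (m : ℕ) (B : Fin m → V) (c : (i : Fin m) → G.Walk (B i) (B i)),
    m ≤ (Fintype.card V - 1) / 2 ∧
    (∀ i, (c i).IsCycle) ∧
    (∀ i j, i ≠ j → ∀ e, e ∈ (c i).edges → e ∉ (c j).edges) ∧
    (∀ e, e ∈ G.edgeSet ↔ ∃ i, e ∈ (c i).edges)

/-- A counterexample to Hajós' conjecture is an Eulerian graph not fulfilling it. -/
def IsCounterexample {V : Type} [Fintype V] (G : SimpleGraph V) : Prop :=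
  IsEulerian G ∧ ¬ FulfilsHajos G

/-- A minimum counterexample: a counterexample with the minimum number of edges among
all counterexamples having the minimum number of vertices. -/
def IsMinCounterexample {V : Type} [Fintype V] (G : SimpleGraph V) : Prop :=
  IsCounterexample G ∧
  (∀ (W : Type) [Fintype W] (H : SimpleGraph W),
      IsCounterexample H → Fintype.card V ≤ Fintype.card W) ∧
  (∀ (W : Type) [Fintype W] (H : SimpleGraph W),
      IsCounterexample H → Fintype.card W = Fintype.card V →
      G.edgeSet.ncard ≤ H.edgeSet.ncard)

section ListCycles

variable {V : Type}

/-- The multiset of edges of the walk from `a` to `b` with the list `l` of inner vertices. -/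
def pathEdges : V → List V → V → Multiset (Sym2 V)
  | a, [], b => {s(a, b)}
  | a, c :: l, b => {s(a, c)} + pathEdges c l b

/-- `CycleDec m E`: the multiset `E` of edges is the sum of at most `m` closed walks without
repeated vertices (a closed walk `a, b, a` using the edge `ab` twice is allowed). -/
inductive CycleDec : ℕ → Multiset (Sym2 V) → Prop
  | zero (m : ℕ) : CycleDec m 0
  | cons {m : ℕ} {E : Multiset (Sym2 V)} (a : V) (l : List V) (hl : l ≠ [])
      (hn : (a :: l).Nodup) (h : CycleDec m E) : CycleDec (m + 1) (pathEdges a l a + E)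

theorem pathEdges_append (a : V) (l : List V) (c : V) (r : List V) (b : V) :
    pathEdges a (l ++ c :: r) b = pathEdges a l c + pathEdges c r b := by
  induction l generalizing a with
  | nil => rfl
  | cons d l ih => simp [pathEdges, ih]

theorem pathEdges_reverse (a : V) (l : List V) (b : V) :
    pathEdges b l.reverse a = pathEdges a l b := by
  induction l generalizing a with
  | nil => simp [pathEdges, Sym2.eq_swap]
  | cons d l ih =>
    rw [List.reverse_cons, pathEdges_append, ih, pathEdges, pathEdges, add_comm, Sym2.eq_swap]

theorem exists_mem_pathEdges {a : V} {l : List V} (b : V) {x : V} (hx : x ∈ a :: l) :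
    ∃ e ∈ pathEdges a l b, x ∈ e := by
  induction l generalizing a with
  | nil => exact ⟨s(a, b), by simp [pathEdges], by simp_all⟩
  | cons d l ih =>
    rcases List.mem_cons.1 hx with rfl | hx
    · exact ⟨s(x, d), by simp [pathEdges], by simp⟩
    · obtain ⟨e, he, hxe⟩ := ih hx
      exact ⟨e, by simp [pathEdges, he], hxe⟩

theorem mem_of_mem_pathEdges {a : V} {l : List V} {b : V} {e : Sym2 V}
    (he : e ∈ pathEdges a l b) {x : V} (hx : x ∈ e) : x ∈ a :: l ∨ x = b := by
  induction l generalizing a with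
  | nil =>
    simp only [pathEdges, Multiset.mem_singleton] at he
    subst he
    simpa using hx
  | cons d l ih =>
    simp only [pathEdges, Multiset.mem_add, Multiset.mem_singleton] at he
    rcases he with rfl | he
    · rcases Sym2.mem_iff.1 hx with rfl | rfl <;> simp
    · rcases ih he with h | h
      · exact Or.inl (List.mem_cons_of_mem _ h)
      · exact Or.inr h

theorem exists_split_of_mem_pathEdges {a : V} {l : List V} {b : V} {e : Sym2 V}
    (he : e ∈ pathEdges a l b) :
    ∃ P x y Q, a :: (l ++ [b]) = P ++ x :: y :: Q ∧ e = s(x, y) := by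
  induction l generalizing a with
  | nil =>
    simp only [pathEdges, Multiset.mem_singleton] at he
    exact ⟨[], a, b, [], rfl, he⟩
  | cons d l ih =>
    simp only [pathEdges, Multiset.mem_add, Multiset.mem_singleton] at he
    rcases he with rfl | he
    · exact ⟨[], a, d, l ++ [b], rfl, rfl⟩
    · obtain ⟨P, x, y, Q, h, rfl⟩ := ih he
      exact ⟨a :: P, x, y, Q, by rw [List.cons_append, h, List.cons_append], rfl⟩

/-- A closed walk can be started at any of its vertices. -/
theorem exists_rotate {c : V} {l : List V} (hn : (c :: l).Nodup) {p : V} (hp : p ∈ c :: l) :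
    ∃ R, pathEdges p R p = pathEdges c l c ∧ (p :: R).Perm (c :: l) ∧ (p :: R).Nodup := by
  rcases List.mem_cons.1 hp with rfl | hp
  · exact ⟨l, rfl, List.Perm.refl _, hn⟩
  · obtain ⟨P, Q, rfl⟩ := List.append_of_mem hp
    have hperm : (p :: (Q ++ c :: P)).Perm (c :: (P ++ p :: Q)) :=
      List.perm_append_comm (l₁ := p :: Q) (l₂ := c :: P)
    exact ⟨Q ++ c :: P, by rw [pathEdges_append, pathEdges_append, add_comm], hperm,
      hperm.nodup_iff.2 hn⟩

/-- A closed walk can be started with any of its edges, in either direction. -/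
theorem exists_rotate_edge {c : V} {l : List V} (hl : l ≠ []) (hn : (c :: l).Nodup) {a b : V}
    (he : s(a, b) ∈ pathEdges c l c) :
    ∃ R, pathEdges a (b :: R) a = pathEdges c l c ∧ (a :: b :: R).Perm (c :: l) ∧
      (a :: b :: R).Nodup := by
  have key : ∃ x y R, s(a, b) = s(x, y) ∧ pathEdges x (y :: R) x = pathEdges c l c ∧
      (x :: y :: R).Perm (c :: l) := by
    obtain ⟨P, x, y, Q, h, hxy⟩ := exists_split_of_mem_pathEdges he
    rcases P with _ | ⟨p, P⟩
    · obtain ⟨d, l, rfl⟩ := List.exists_cons_of_ne_nil hl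
      simp only [List.cons_append, List.nil_append, List.cons.injEq] at h
      obtain ⟨rfl, rfl, -⟩ := h
      exact ⟨c, d, l, hxy, rfl, List.Perm.refl _⟩
    · simp only [List.cons_append, List.cons.injEq] at h
      obtain ⟨rfl, h⟩ := h
      rcases List.eq_nil_or_concat Q with rfl | ⟨Q, z, rfl⟩
      · have h' : l ++ [c] = (P ++ [x]) ++ [y] := by simpa using h
        obtain ⟨rfl, h2⟩ := List.append_inj' h' rfl
        obtain rfl : c = y := by simpa using h2
        refine ⟨x, c, P, hxy, ?_, List.perm_append_comm (l₁ := [x]) (l₂ := c :: P)⟩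
        rw [pathEdges_append, pathEdges, pathEdges, add_comm]
      · have h' : l ++ [c] = (P ++ x :: y :: Q) ++ [z] := by simpa using h
        obtain ⟨rfl, -⟩ := List.append_inj' h' rfl
        refine ⟨x, y, Q ++ c :: P, hxy, ?_,
          List.perm_append_comm (l₁ := x :: y :: Q) (l₂ := c :: P)⟩
        rw [pathEdges_append, pathEdges, pathEdges_append, pathEdges]
        abel
  obtain ⟨x, y, R, he, h1, h2⟩ := key
  rcases Sym2.eq_iff.1 he with ⟨rfl, rfl⟩ | ⟨rfl, rfl⟩
  · exact ⟨R, h1, h2, h2.nodup_iff.2 hn⟩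
  · have h3 : (a :: b :: R.reverse).Perm (c :: l) :=
      ((List.Perm.swap b a _).trans (((List.reverse_perm R).cons a).cons b)).trans h2
    refine ⟨R.reverse, ?_, h3, h3.nodup_iff.2 hn⟩
    rw [← h1, pathEdges, pathEdges, pathEdges_reverse, Sym2.eq_swap]

/-- The second neighbour of a vertex on a closed walk is the first vertex after it. -/
theorem eq_of_mem_pathEdges {a b : V} {R : List V} (hn : (a :: b :: R).Nodup) {x : V}
    (hx : s(b, x) ∈ pathEdges a (b :: R) a) (hxa : x ≠ a) : ∃ R', R = x :: R' := by
  simp only [List.nodup_cons, List.mem_cons, not_or] at hn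
  obtain ⟨⟨hab, haR⟩, hbR, -⟩ := hn
  simp only [pathEdges, Multiset.mem_add, Multiset.mem_singleton] at hx
  rcases hx with hx | hx
  · rcases Sym2.eq_iff.1 hx with ⟨rfl, rfl⟩ | ⟨-, rfl⟩
    · exact absurd rfl hab
    · exact absurd rfl hxa
  · rcases R with _ | ⟨r, R⟩
    · simp only [pathEdges, Multiset.mem_singleton] at hx
      rcases Sym2.eq_iff.1 hx with ⟨-, rfl⟩ | ⟨rfl, -⟩
      · exact absurd rfl hxa
      · exact absurd rfl hab
    · simp only [pathEdges, Multiset.mem_add, Multiset.mem_singleton] at hx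
      rcases hx with hx | hx
      · rcases Sym2.eq_iff.1 hx with ⟨-, rfl⟩ | ⟨rfl, -⟩
        · exact ⟨R, rfl⟩
        · simp at hbR
      · rcases mem_of_mem_pathEdges hx (Sym2.mem_mk_left b x) with h | h
        · exact absurd h hbR
        · exact absurd h.symm hab

namespace CycleDec

theorem mono {m m' : ℕ} {E : Multiset (Sym2 V)} (h : CycleDec m E) (hm : m ≤ m') :
    CycleDec m' E := by
  induction h generalizing m' with
  | zero m => exact .zero _
  | cons a l hl hn h ih =>
    obtain ⟨k, rfl⟩ : ∃ k, m' = k + 1 := ⟨m' - 1, by omega⟩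
    exact .cons a l hl hn (ih (by omega))

theorem add {m m' : ℕ} {E E' : Multiset (Sym2 V)} (h : CycleDec m E) (h' : CycleDec m' E') :
    CycleDec (m + m') (E + E') := by
  induction h with
  | zero m => simpa using h'.mono (by omega)
  | cons a l hl hn h ih =>
    rw [Multiset.add_assoc]
    exact (CycleDec.cons a l hl hn ih).mono (Nat.add_right_comm _ _ _).le

/-- The closed walk of a decomposition containing a given edge. -/
theorem extract {m : ℕ} {E : Multiset (Sym2 V)} (h : CycleDec m E) {a b : V}
    (he : s(a, b) ∈ E) :
    ∃ R k E', E = pathEdges a (b :: R) a + E' ∧ (a :: b :: R).Nodup ∧ CycleDec k E' ∧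
      m = k + 1 := by
  induction h with
  | zero m => simp at he
  | @cons m E c l hl hn h ih =>
    by_cases hc : s(a, b) ∈ pathEdges c l c
    · obtain ⟨R, h1, -, h3⟩ := exists_rotate_edge hl hn hc
      exact ⟨R, m, E, by rw [h1], h3, h, rfl⟩
    · obtain ⟨R, k, E', rfl, h2, h3, rfl⟩ := ih ((Multiset.mem_add.1 he).resolve_left hc)
      exact ⟨R, k + 1, _, add_left_comm _ _ _, h2, .cons c l hl hn h3, rfl⟩

/-- The edge `ab` of a decomposition can be replaced by the path `a, w, b`. -/
theorem reroute {m : ℕ} {E : Multiset (Sym2 V)} {a b w : V} (h : CycleDec m ({s(a, b)} + E))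
    (hw : ∀ e ∈ ({s(a, b)} + E : Multiset (Sym2 V)), w ∉ e) :
    CycleDec m ({s(a, w)} + {s(w, b)} + E) := by
  obtain ⟨R, k, E', hE, hn, h', rfl⟩ := h.extract (a := a) (b := b) (by simp)
  have hE' : E = pathEdges b R a + E' := by
    rw [pathEdges, add_assoc] at hE
    exact add_left_cancel hE
  have hwR : w ∉ a :: b :: R := by
    intro hmem
    obtain ⟨e, he, hwe⟩ := exists_mem_pathEdges a hmem
    exact hw e (by rw [hE]; exact Multiset.mem_add.2 (Or.inl he)) hwe
  have := CycleDec.cons a (w :: b :: R) (by simp)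
    (by simp only [List.nodup_cons, List.mem_cons, not_or] at hn hwR ⊢; tauto) h'
  convert this using 1
  rw [hE', pathEdges, pathEdges]
  abel

end CycleDec

end ListCycles

section Moves

variable {V : Type}

/-- The edges at two adjacent vertices `u` and `v` whose common neighbours are `a, b, c, d, e`. -/
def starEdges (u v a b c d e : V) : Multiset (Sym2 V) :=
  {s(u, v)} + ({s(u, a)} + {s(v, a)}) + ({s(u, b)} + {s(v, b)}) + ({s(u, c)} + {s(v, c)}) +
    ({s(u, d)} + {s(v, d)}) + ({s(u, e)} + {s(v, e)})

/-- No edge of `E` is incident with `w`. -/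
def Avoids (w : V) (E : Multiset (Sym2 V)) : Prop := ∀ e ∈ E, w ∉ e

theorem avoids_add {w : V} {E F : Multiset (Sym2 V)} :
    Avoids w (E + F) ↔ Avoids w E ∧ Avoids w F := by
  simp only [Avoids, Multiset.mem_add, or_imp, forall_and]

theorem avoids_singleton {w a b : V} :
    Avoids w ({s(a, b)} : Multiset (Sym2 V)) ↔ w ≠ a ∧ w ≠ b := by
  simp [Avoids]

theorem avoids_pathEdges {w a b : V} {l : List V} (h : Avoids w (pathEdges a l b)) :
    w ∉ a :: l := fun hm ↦
  let ⟨e, he, hwe⟩ := exists_mem_pathEdges b hm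
  h e he hwe

namespace CycleDec

theorem congr {m : ℕ} {E E' : Multiset (Sym2 V)} (h : CycleDec m E) (hE : E = E') :
    CycleDec m E' := hE ▸ h

/-- Reroute `ab` along `a, u, v, b`, the edge `cd` through `u` and the edge `ef` through `v`,
where `ab` lies on another closed walk than `cd` and `ef`. -/
theorem reroute_three {k : ℕ} {u v a b c d e f : V} {R : List V} {E : Multiset (Sym2 V)}
    (huv : u ≠ v) (hn : (a :: b :: R).Nodup) (h : CycleDec k ({s(c, d)} + {s(e, f)} + E))
    (hu : Avoids u (pathEdges a (b :: R) a + ({s(c, d)} + {s(e, f)} + E)))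
    (hv : Avoids v (pathEdges a (b :: R) a + ({s(c, d)} + {s(e, f)} + E))) :
    CycleDec (k + 1) ({s(a, u)} + {s(u, v)} + {s(v, b)} + {s(c, u)} + {s(u, d)} + {s(e, v)} +
      {s(v, f)} + pathEdges b R a + E) := by
  rw [avoids_add] at hu hv
  rw [add_assoc] at h
  have h1 := h.reroute (w := u) (by rw [← add_assoc]; exact hu.2)
  rw [add_left_comm] at h1
  have h2 := h1.reroute (w := v) (by
    have := hv.2
    change Avoids v _
    simp only [avoids_add, avoids_singleton] at this ⊢
    exact ⟨this.1.2, ⟨⟨this.1.1.1, huv.symm⟩, huv.symm, this.1.1.2⟩, this.2⟩)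
  have hu' := avoids_pathEdges hu.1
  have hv' := avoids_pathEdges hv.1
  have h3 := CycleDec.cons a (u :: v :: b :: R) (by simp)
    (by simp only [List.nodup_cons, List.mem_cons, not_or] at hn hu' hv' ⊢; tauto) h2
  refine h3.congr ?_
  simp only [pathEdges]
  abel

section

variable {k : ℕ} {u v a b c d e : V} {E : Multiset (Sym2 V)}

theorem star_two_more (hn : [u, v, a, b, c, d, e].Nodup) (h : CycleDec k E)
    (hu : Avoids u E) (hv : Avoids v E) (hab : s(a, b) ∈ E) :
    CycleDec (k + 2) (starEdges u v a b c d e + E) := by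
  obtain ⟨R, k, E, rfl, hR, h', rfl⟩ := h.extract hab
  have hu' := avoids_pathEdges (avoids_add.1 hu).1
  have hv' := avoids_pathEdges (avoids_add.1 hv).1
  simp only [List.nodup_cons, List.mem_cons, not_or, List.not_mem_nil] at hn hu' hv' hR
  have h1 := CycleDec.cons a (u :: v :: b :: R) (by simp)
    (by simp only [List.nodup_cons, List.mem_cons, not_or]; grind) h'
  have h2 := CycleDec.cons u [b, a, v, c] (by simp) (by simp; grind) h1
  have h3 := CycleDec.cons u [d, v, e] (by simp) (by simp; grind) h2
  refine h3.congr ?_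
  simp only [pathEdges, starEdges, Sym2.eq_swap]
  abel

/-- Three edges `ab, bc, ca` among the common neighbours are replaced by paths via `u` and `v`. -/
theorem star_triangle {R : List V} (hn : [u, v, a, b, c, d, e].Nodup) (hR : (a :: b :: R).Nodup)
    (h : CycleDec k ({s(b, c)} + {s(c, a)} + E))
    (hu : Avoids u (pathEdges a (b :: R) a + ({s(b, c)} + {s(c, a)} + E)))
    (hv : Avoids v (pathEdges a (b :: R) a + ({s(b, c)} + {s(c, a)} + E))) :
    CycleDec (k + 2) (starEdges u v a b c d e + (pathEdges b R a + E)) := by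
  simp only [List.nodup_cons, List.mem_cons, not_or, List.not_mem_nil] at hn
  have h1 := h.reroute_three hn.1.1 hR hu hv
  have h2 := CycleDec.cons u [d, v, e] (by simp) (by simp; grind) h1
  refine h2.congr ?_
  simp only [pathEdges, starEdges, Sym2.eq_swap]
  abel

/-- Three edges `ab, bc, cd` among the common neighbours are replaced by paths via `u` and `v`,
and a path from `a` to `d` is added, where `ab` is on another closed walk than `bc` and `cd`. -/
theorem star_path_fst {R N : List V} (hn : [u, v, a, b, c, d, e].Nodup) (hR : (a :: b :: R).Nodup)
    (h : CycleDec k ({s(b, c)} + {s(c, d)} + E))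
    (hu : Avoids u (pathEdges a (b :: R) a + ({s(b, c)} + {s(c, d)} + E)))
    (hv : Avoids v (pathEdges a (b :: R) a + ({s(b, c)} + {s(c, d)} + E)))
    (hN : (u :: v :: e :: a :: d :: N).Nodup) :
    CycleDec (k + 2) (starEdges u v a b c d e + (pathEdges a N d + pathEdges b R a + E)) := by
  simp only [List.nodup_cons, List.mem_cons, not_or, List.not_mem_nil] at hn hN
  have h1 := h.reroute_three hn.1.1 hR hu hv
  have h2 := CycleDec.cons u (e :: v :: a :: (N ++ [d])) (by simp)
    (by simp [List.nodup_append]; grind) h1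
  refine h2.congr ?_
  simp only [pathEdges, pathEdges_append, starEdges, Sym2.eq_swap]
  abel

/-- Three edges `ab, bc, cd` among the common neighbours are replaced by paths via `u` and `v`,
and a path from `a` to `d` is added, where `bc` is on another closed walk than `ab` and `cd`. -/
theorem star_path_snd {R N : List V} (hn : [u, v, a, b, c, d, e].Nodup) (hR : (b :: c :: R).Nodup)
    (h : CycleDec k ({s(c, d)} + {s(a, b)} + E))
    (hu : Avoids u (pathEdges b (c :: R) b + ({s(c, d)} + {s(a, b)} + E)))
    (hv : Avoids v (pathEdges b (c :: R) b + ({s(c, d)} + {s(a, b)} + E)))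
    (hN : (u :: v :: e :: a :: d :: N).Nodup) :
    CycleDec (k + 2) (starEdges u v a b c d e + (pathEdges a N d + pathEdges c R b + E)) := by
  simp only [List.nodup_cons, List.mem_cons, not_or, List.not_mem_nil] at hn hN
  have h1 := h.reroute_three hn.1.1 hR hu hv
  have h2 := CycleDec.cons u (a :: (N ++ [d, v, e])) (by simp)
    (by simp [List.nodup_append]; grind) h1
  refine h2.congr ?_
  simp only [pathEdges, pathEdges_append, starEdges, Sym2.eq_swap]
  abel

/-- Two closed walks, one with the edge `ab`, and one with a path `c P d` off `a, b` whose
complement is off `e`. -/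
theorem star_disjoint {R P Q : List V} (hn : [u, v, a, b, c, d, e].Nodup)
    (hR : (a :: b :: R).Nodup) (hD : (c :: (P ++ d :: Q)).Nodup) (h : CycleDec k E)
    (hu : Avoids u (pathEdges a (b :: R) a + (pathEdges c (P ++ d :: Q) c + E)))
    (hv : Avoids v (pathEdges a (b :: R) a + (pathEdges c (P ++ d :: Q) c + E)))
    (haP : a ∉ P) (hbP : b ∉ P) (heQ : e ∉ Q) :
    CycleDec (k + 3) (starEdges u v a b c d e +
      (pathEdges a (b :: R) a + (pathEdges c (P ++ d :: Q) c + E))) := by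
  rw [avoids_add, avoids_add] at hu hv
  have hu1 := avoids_pathEdges hu.1
  have hu2 := avoids_pathEdges hu.2.1
  have hv1 := avoids_pathEdges hv.1
  have hv2 := avoids_pathEdges hv.2.1
  simp only [List.nodup_cons, List.nodup_append, List.mem_cons, List.mem_append, not_or,
    List.not_mem_nil] at hn hu1 hu2 hv1 hv2 hR hD
  have h1 := CycleDec.cons a (u :: v :: b :: R) (by simp)
    (by simp only [List.nodup_cons, List.mem_cons, not_or]; grind) h
  have h2 := CycleDec.cons c (v :: e :: u :: d :: Q) (by simp)
    (by simp only [List.nodup_cons, List.mem_cons, not_or]; grind) h1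
  have h3 := CycleDec.cons u (c :: (P ++ [d, v, a, b])) (by simp)
    (by simp [List.nodup_append]; grind) h2
  refine h3.congr ?_
  simp only [pathEdges, pathEdges_append, starEdges, Sym2.eq_swap]
  abel

/-- Two closed walks, one with the edge `ab`, and one with a path `b P c` off `a, e` whose
complement is off `d`. -/
theorem star_consecutive {R P Q : List V} (hn : [u, v, a, b, c, d, e].Nodup)
    (hR : (a :: b :: R).Nodup) (hD : (b :: (P ++ c :: Q)).Nodup) (h : CycleDec k E)
    (hu : Avoids u (pathEdges a (b :: R) a + (pathEdges b (P ++ c :: Q) b + E)))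
    (hv : Avoids v (pathEdges a (b :: R) a + (pathEdges b (P ++ c :: Q) b + E)))
    (haP : a ∉ P) (heP : e ∉ P) (hdQ : d ∉ Q) :
    CycleDec (k + 3) (starEdges u v a b c d e +
      (pathEdges a (b :: R) a + (pathEdges b (P ++ c :: Q) b + E))) := by
  rw [avoids_add, avoids_add] at hu hv
  have hu1 := avoids_pathEdges hu.1
  have hu2 := avoids_pathEdges hu.2.1
  have hv1 := avoids_pathEdges hv.1
  have hv2 := avoids_pathEdges hv.2.1
  simp only [List.nodup_cons, List.nodup_append, List.mem_cons, List.mem_append, not_or,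
    List.not_mem_nil] at hn hu1 hu2 hv1 hv2 hR hD
  have h1 := CycleDec.cons a (u :: v :: b :: R) (by simp)
    (by simp only [List.nodup_cons, List.mem_cons, not_or]; grind) h
  have h2 := CycleDec.cons b (u :: d :: v :: c :: Q) (by simp)
    (by simp only [List.nodup_cons, List.mem_cons, not_or]; grind) h1
  have h3 := CycleDec.cons a (b :: (P ++ [c, u, e, v])) (by simp)
    (by simp [List.nodup_append]; grind) h2
  refine h3.congr ?_
  simp only [pathEdges, pathEdges_append, starEdges, Sym2.eq_swap]
  abel

end

end CycleDec

end Moves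

section TwoWalks

variable {V : Type}

/-- `F` is the set of edges of a closed walk that contains the edge `ab`. -/
def IsCycleThrough (F : Multiset (Sym2 V)) (a b : V) : Prop :=
  ∃ R, F = pathEdges a (b :: R) a ∧ (a :: b :: R).Nodup

theorem IsCycleThrough.symm {F : Multiset (Sym2 V)} {a b : V} (h : IsCycleThrough F a b) :
    IsCycleThrough F b a := by
  obtain ⟨R, rfl, hR⟩ := h
  obtain ⟨R', h1, -, h2⟩ := exists_rotate_edge (a := b) (b := a) (by simp) hR
    (by simp [pathEdges, Sym2.eq_swap])
  exact ⟨R', h1.symm, h2⟩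

theorem List.exists_first {p : V → Prop} {l : List V} (h : ∃ x ∈ l, p x) :
    ∃ P q Q, l = P ++ q :: Q ∧ p q ∧ ∀ x ∈ P, ¬ p x := by
  induction l with
  | nil => simp at h
  | cons a l ih =>
    by_cases ha : p a
    · exact ⟨[], a, l, rfl, ha, by simp⟩
    · obtain ⟨P, q, Q, rfl, hq, hP⟩ := ih (by simpa [ha] using h)
      exact ⟨a :: P, q, Q, rfl, hq, by simpa [ha] using hP⟩

theorem nodup_seven {u v a b c d e : V} : [u, v, a, b, c, d, e].Nodup ↔
    ((u ≠ v ∧ u ≠ a ∧ u ≠ b ∧ u ≠ c ∧ u ≠ d ∧ u ≠ e) ∧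
    (v ≠ a ∧ v ≠ b ∧ v ≠ c ∧ v ≠ d ∧ v ≠ e) ∧ (a ≠ b ∧ a ≠ c ∧ a ≠ d ∧ a ≠ e) ∧
    (b ≠ c ∧ b ≠ d ∧ b ≠ e) ∧ (c ≠ d ∧ c ≠ e) ∧ d ≠ e) := by
  simp only [List.nodup_cons, List.mem_cons, not_or, List.not_mem_nil, List.nodup_nil,
    not_false_eq_true, and_true, ne_eq]

theorem nodup_cons_append_cons {x y : V} {P Q : List V} (h : (x :: (P ++ y :: Q)).Nodup) :
    (y :: (Q ++ x :: P)).Nodup :=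
  (List.perm_append_comm (l₁ := x :: P) (l₂ := y :: Q)).nodup_iff.1 h

theorem pathEdges_cons_append_cons (x y : V) (P Q : List V) :
    pathEdges x (P ++ y :: Q) x = pathEdges y (Q ++ x :: P) y := by
  rw [pathEdges_append, pathEdges_append, add_comm]

theorem notMem_of_nodup_middle {x y z : V} {P Q : List V} (h : (x :: (P ++ y :: Q)).Nodup)
    (hz : z ∈ x :: y :: Q) : z ∉ P := by
  simp only [List.nodup_cons, List.nodup_append, List.mem_cons, List.mem_append] at h hz
  intro hzP
  have := h.2.2.2 z hzP
  grind

theorem notMem_of_nodup_last {x y z : V} {P Q : List V} (h : (x :: (P ++ y :: Q)).Nodup)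
    (hz : z ∈ x :: y :: P) : z ∉ Q :=
  notMem_of_nodup_middle (nodup_cons_append_cons h) (by simp only [List.mem_cons] at hz ⊢; tauto)

namespace CycleDec

variable {k : ℕ} {u v a b c d e : V} {E F : Multiset (Sym2 V)}

theorem star_of_first {P Q : List V} (hn : [u, v, a, b, c, d, e].Nodup)
    (hF : IsCycleThrough F a b) (hD : (b :: (P ++ c :: Q)).Nodup) (h : CycleDec k E)
    (hu : Avoids u (F + (pathEdges b (P ++ c :: Q) b + E)))
    (hv : Avoids v (F + (pathEdges b (P ++ c :: Q) b + E)))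
    (haP : a ∉ P) (hdP : d ∉ P) (heP : e ∉ P) :
    CycleDec (k + 3) (starEdges u v a b c d e + (F + (pathEdges b (P ++ c :: Q) b + E))) := by
  rw [nodup_seven] at hn
  have hFs := hF.symm
  obtain ⟨R', hF', hR'⟩ := hFs
  obtain ⟨R, rfl, hR⟩ := hF
  by_cases hdQ : d ∈ Q
  swap
  · exact star_consecutive (nodup_seven.2 hn) hR hD h hu hv haP heP hdQ
  by_cases heQ : e ∈ Q
  swap
  · refine (star_consecutive (d := e) (e := d)
      (by rw [nodup_seven]; clear * - hn; tauto) hR hD h hu hv haP hdP heQ).congr ?_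
    simp only [starEdges]
    abel
  obtain ⟨Q₁, y, Q₂, rfl, hy, hQ₁⟩ :=
    List.exists_first (p := fun x ↦ x = a ∨ x = d ∨ x = e) ⟨d, hdQ, by simp⟩
  have haQ₁ : a ∉ Q₁ := fun h ↦ hQ₁ a h (by simp)
  have hdQ₁ : d ∉ Q₁ := fun h ↦ hQ₁ d h (by simp)
  have heQ₁ : e ∉ Q₁ := fun h ↦ hQ₁ e h (by simp)
  have hsplit : P ++ c :: (Q₁ ++ y :: Q₂) = (P ++ c :: Q₁) ++ y :: Q₂ := by simp
  rw [hsplit] at hu hv hD ⊢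
  have hPQ : ∀ z, z ≠ c → z ∉ P → z ∉ Q₁ → z ∉ P ++ c :: Q₁ := by
    intro z h1 h2 h3
    simp only [List.mem_append, List.mem_cons]
    tauto
  rcases hy with rfl | rfl | rfl
  · have hyd : d ∈ Q₂ := by
      simp only [List.mem_append, List.mem_cons] at hdQ
      clear * - hdQ hdQ₁ hn
      grind
    have hye : e ∈ Q₂ := by
      simp only [List.mem_append, List.mem_cons] at heQ
      clear * - heQ heQ₁ hn
      grind
    have hperm := nodup_cons_append_cons hD
    rw [pathEdges_cons_append_cons, hF'] at hu hv ⊢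
    obtain ⟨Q₃, z, Q₄, rfl, hz, hQ₃⟩ :=
      List.exists_first (l := Q₂) (p := fun x ↦ x = d ∨ x = e) ⟨d, hyd, by simp⟩
    have hdQ₃ : d ∉ Q₃ := fun h ↦ hQ₃ d h (by simp)
    have heQ₃ : e ∉ Q₃ := fun h ↦ hQ₃ e h (by simp)
    rcases hz with rfl | rfl
    · obtain ⟨Q₅, Q₆, rfl⟩ := List.append_of_mem (a := e) (l := Q₄) (by
        simp only [List.mem_append, List.mem_cons] at hye
        clear * - hye heQ₃ hn
        grind)
      have hsplit : Q₃ ++ z :: (Q₅ ++ e :: Q₆) ++ b :: (P ++ c :: Q₁) =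
        (Q₃ ++ z :: Q₅) ++ e :: (Q₆ ++ b :: (P ++ c :: Q₁)) := by simp
      rw [hsplit] at hu hv hperm ⊢
      have h1 := fun z ↦ notMem_of_nodup_middle (z := z) hperm
      have h2 := fun z ↦ notMem_of_nodup_last (z := z) hperm
      refine (star_consecutive (a := b) (b := y) (c := e) (d := z) (e := c)
        (by rw [nodup_seven]; clear * - hn; tauto) hR' hperm h
        hu hv (h1 _ (by simp)) (h1 _ (by simp)) (h2 _ (by simp))).congr ?_
      simp only [starEdges]
      abel
    · obtain ⟨Q₅, Q₆, rfl⟩ := List.append_of_mem (a := d) (l := Q₄) (by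
        simp only [List.mem_append, List.mem_cons] at hyd
        clear * - hyd hdQ₃ hn
        grind)
      have hsplit : Q₃ ++ z :: (Q₅ ++ d :: Q₆) ++ b :: (P ++ c :: Q₁) =
        (Q₃ ++ z :: Q₅) ++ d :: (Q₆ ++ b :: (P ++ c :: Q₁)) := by simp
      rw [hsplit] at hu hv hperm ⊢
      have h1 := fun z ↦ notMem_of_nodup_middle (z := z) hperm
      have h2 := fun z ↦ notMem_of_nodup_last (z := z) hperm
      refine (star_consecutive (a := b) (b := y) (c := d) (d := z) (e := c)
        (by rw [nodup_seven]; clear * - hn; tauto) hR' hperm h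
        hu hv (h1 _ (by simp)) (h1 _ (by simp)) (h2 _ (by simp))).congr ?_
      simp only [starEdges]
      abel
  · refine (star_consecutive (c := y) (d := c) (e := e)
      (by rw [nodup_seven]; clear * - hn; tauto) hR hD h hu hv
      (hPQ _ hn.2.2.1.2.1 haP haQ₁) (hPQ _ hn.2.2.2.2.1.2.symm heP heQ₁)
      (notMem_of_nodup_last hD (by simp))).congr ?_
    simp only [starEdges]
    abel
  · refine (star_consecutive (c := y) (d := c) (e := d)
      (by rw [nodup_seven]; clear * - hn; tauto) hR hD h hu hv
      (hPQ _ hn.2.2.1.2.1 haP haQ₁) (hPQ _ hn.2.2.2.2.1.1.symm hdP hdQ₁)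
      (notMem_of_nodup_last hD (by simp))).congr ?_
    simp only [starEdges]
    abel

theorem star_of_first' {P Q : List V} (hn : [u, v, a, b, c, d, e].Nodup)
    (hF : IsCycleThrough F a b) (hD : (b :: (P ++ c :: Q)).Nodup) (h : CycleDec k E)
    (hu : Avoids u (F + (pathEdges b (P ++ c :: Q) b + E)))
    (hv : Avoids v (F + (pathEdges b (P ++ c :: Q) b + E))) (hdP : d ∉ P) (heP : e ∉ P) :
    CycleDec (k + 3) (starEdges u v a b c d e + (F + (pathEdges b (P ++ c :: Q) b + E))) := by
  by_cases haP : a ∈ P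
  swap
  · exact star_of_first hn hF hD h hu hv haP hdP heP
  obtain ⟨P₁, P₂, rfl⟩ := List.append_of_mem haP
  have hsplit : (P₁ ++ a :: P₂) ++ c :: Q = P₁ ++ a :: (P₂ ++ c :: Q) := by simp
  have hsplit' : (P₂ ++ c :: Q) ++ b :: P₁ = P₂ ++ c :: (Q ++ b :: P₁) := by simp
  rw [hsplit] at hu hv hD ⊢
  rw [pathEdges_cons_append_cons, hsplit'] at hu hv ⊢
  have hperm := nodup_cons_append_cons hD
  rw [hsplit'] at hperm
  simp only [List.mem_append, List.mem_cons, not_or] at hdP heP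
  refine (star_of_first (a := b) (b := a) (c := c) (d := d) (e := e)
    (by rw [nodup_seven] at hn ⊢; clear * - hn; tauto) hF.symm hperm h hu hv
    (notMem_of_nodup_middle hperm (by simp)) hdP.2.2 heP.2.2).congr ?_
  simp only [starEdges]
  abel

theorem star_of_mem {l : List V} (hn : [u, v, a, b, c, d, e].Nodup)
    (hF : IsCycleThrough F a b) (hD : (b :: l).Nodup) (h : CycleDec k E)
    (hu : Avoids u (F + (pathEdges b l b + E))) (hv : Avoids v (F + (pathEdges b l b + E)))
    (hl : c ∈ l ∨ d ∈ l ∨ e ∈ l) :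
    CycleDec (k + 3) (starEdges u v a b c d e + (F + (pathEdges b l b + E))) := by
  obtain ⟨P, q, Q, rfl, hq, hP⟩ :=
    List.exists_first (l := l) (p := fun x ↦ x = c ∨ x = d ∨ x = e) (by
      rcases hl with hl | hl | hl <;> exact ⟨_, hl, by simp⟩)
  have hcP : c ∉ P := fun h ↦ hP c h (by simp)
  have hdP : d ∉ P := fun h ↦ hP d h (by simp)
  have heP : e ∉ P := fun h ↦ hP e h (by simp)
  rcases hq with rfl | rfl | rfl
  · exact star_of_first' hn hF hD h hu hv hdP heP
  · refine (star_of_first' (c := q) (d := c) (e := e)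
      (by rw [nodup_seven] at hn ⊢; clear * - hn; tauto) hF hD h hu hv hcP heP).congr ?_
    simp only [starEdges]
    abel
  · refine (star_of_first' (c := q) (d := c) (e := d)
      (by rw [nodup_seven] at hn ⊢; clear * - hn; tauto) hF hD h hu hv hcP hdP).congr ?_
    simp only [starEdges]
    abel

theorem star_of_pair {l : List V} (hn : [u, v, a, b, c, d, e].Nodup)
    (hF : IsCycleThrough F a b) (hD : (c :: l).Nodup) (h : CycleDec k E)
    (hu : Avoids u (F + (pathEdges c l c + E))) (hv : Avoids v (F + (pathEdges c l c + E)))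
    (ha : a ∉ l) (hb : b ∉ l) (hd : d ∈ l) :
    CycleDec (k + 3) (starEdges u v a b c d e + (F + (pathEdges c l c + E))) := by
  obtain ⟨R, rfl, hR⟩ := hF
  obtain ⟨P, Q, rfl⟩ := List.append_of_mem hd
  simp only [List.mem_append, List.mem_cons, not_or] at ha hb
  by_cases heQ : e ∈ Q
  · have hperm := nodup_cons_append_cons hD
    rw [pathEdges_cons_append_cons] at hu hv ⊢
    refine (star_disjoint (c := d) (d := c) (e := e)
      (by rw [nodup_seven] at hn ⊢; clear * - hn; tauto) hR hperm h hu hv ha.2.2 hb.2.2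
      (notMem_of_nodup_last hperm (List.mem_cons_of_mem _ (List.mem_cons_of_mem _ heQ)))).congr ?_
    simp only [starEdges]
    abel
  · exact star_disjoint hn hR hD h hu hv ha.1 hb.1 heQ

theorem star_of_two_mem {x y : V} {l : List V} (hn : [u, v, a, b, c, d, e].Nodup)
    (hF : IsCycleThrough F a b) (hD : (x :: l).Nodup) (h : CycleDec k E)
    (hu : Avoids u (F + (pathEdges x l x + E))) (hv : Avoids v (F + (pathEdges x l x + E)))
    (hx : x = c ∨ x = d ∨ x = e) (hy : y ∈ l) (hy' : y ∈ [a, b, c, d, e]) :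
    CycleDec (k + 3) (starEdges u v a b c d e + (F + (pathEdges x l x + E))) := by
  by_cases hb : b ∈ l
  · obtain ⟨l', h1, h2, h3⟩ := exists_rotate hD (List.mem_cons_of_mem _ hb)
    rw [← h1] at hu hv ⊢
    have hx' : x ∈ b :: l' := h2.mem_iff.2 (by simp)
    exact star_of_mem hn hF h3 h hu hv (by grind)
  by_cases ha : a ∈ l
  · obtain ⟨l', h1, h2, h3⟩ := exists_rotate hD (List.mem_cons_of_mem _ ha)
    rw [← h1] at hu hv ⊢
    have hx' : x ∈ a :: l' := h2.mem_iff.2 (by simp)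
    refine (star_of_mem (a := b) (b := a) (c := c) (d := d) (e := e) (by rw [nodup_seven] at hn ⊢; clear * - hn; tauto) hF.symm h3 h hu hv
      (by grind)).congr ?_
    simp only [starEdges]
    abel
  have key : ∀ c' d' e', [u, v, a, b, c', d', e'].Nodup →
      starEdges u v a b c' d' e' = starEdges u v a b c d e → x = c' → y = d' →
      CycleDec (k + 3) (starEdges u v a b c d e + (F + (pathEdges x l x + E))) := by
    rintro c' d' e' hn' hs rfl rfl
    exact (star_of_pair hn' hF hD h hu hv ha hb hy).congr (by rw [hs])
  have hxy : x ≠ y := by grind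
  have hy'' : y = c ∨ y = d ∨ y = e := by grind
  rcases hx with hx | hx | hx <;> rcases hy'' with hy'' | hy'' | hy'' <;>
    first
    | exact absurd (hx.trans hy''.symm) hxy
    | exact key c d e (by rw [nodup_seven] at hn ⊢; clear * - hn; tauto) (by simp only [starEdges]) hx hy''
    | exact key c e d (by rw [nodup_seven] at hn ⊢; clear * - hn; tauto) (by simp only [starEdges]; abel) hx hy''
    | exact key d c e (by rw [nodup_seven] at hn ⊢; clear * - hn; tauto) (by simp only [starEdges]; abel) hx hy''
    | exact key d e c (by rw [nodup_seven] at hn ⊢; clear * - hn; tauto) (by simp only [starEdges]; abel) hx hy''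
    | exact key e c d (by rw [nodup_seven] at hn ⊢; clear * - hn; tauto) (by simp only [starEdges]; abel) hx hy''
    | exact key e d c (by rw [nodup_seven] at hn ⊢; clear * - hn; tauto) (by simp only [starEdges]; abel) hx hy''

/-- Two edges among the common neighbours lying on different closed walks allow to decompose
the star edges with a single additional closed walk. -/
theorem star_of_two_edges {x y : V} (hn : [u, v, a, b, c, d, e].Nodup)
    (hF : IsCycleThrough F a b) (h : CycleDec k E) (hu : Avoids u (F + E)) (hv : Avoids v (F + E))
    (hxy : s(x, y) ∈ E) (hne : s(x, y) ≠ s(a, b)) (hx : x ∈ [a, b, c, d, e])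
    (hy : y ∈ [a, b, c, d, e]) :
    CycleDec (k + 2) (starEdges u v a b c d e + (F + E)) := by
  have key : ∀ x y, s(x, y) ∈ E → y ∈ [a, b, c, d, e] → (x = c ∨ x = d ∨ x = e) →
      CycleDec (k + 2) (starEdges u v a b c d e + (F + E)) := by
    intro x y hxy hy hx
    obtain ⟨R, k, E, rfl, hD, h', rfl⟩ := h.extract hxy
    exact star_of_two_mem hn hF hD h' hu hv hx (y := y) (by simp) hy
  by_cases hxc : x = c ∨ x = d ∨ x = e
  · exact key x y hxy hy hxc
  by_cases hyc : y = c ∨ y = d ∨ y = e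
  · exact key y x (Sym2.eq_swap ▸ hxy) hx hyc
  have hnl : x ≠ y := by
    rintro rfl
    obtain ⟨R, k, E, -, hD, -, -⟩ := h.extract hxy
    simp at hD
  refine absurd (Sym2.eq_iff.2 ?_) hne
  grind

end CycleDec

end TwoWalks

section CommonNeighbours

variable {V : Type}

theorem starEdges_perm {u v a b c d e a' b' c' d' e' : V}
    (h : [a, b, c, d, e].Perm [a', b', c', d', e']) :
    starEdges u v a b c d e = starEdges u v a' b' c' d' e' := by
  have key : ∀ a b c d e, starEdges u v a b c d e = {s(u, v)} +
      ([a, b, c, d, e].map fun x ↦ ({s(u, x)} + {s(v, x)} : Multiset (Sym2 V))).sum := by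
    intro a b c d e
    simp only [starEdges, List.map_cons, List.sum_cons, List.map_nil, List.sum_nil]
    abel
  rw [key, key, (h.map _).sum_eq]

theorem List.exists_perm_of_mem_mem {X : List V} (hX : X.length = 5) {x y : V} (hx : x ∈ X)
    (hy : y ∈ X) (hxy : x ≠ y) : ∃ c d e, [x, y, c, d, e].Perm X := by
  classical
  have h1 := List.perm_cons_erase hx
  have hy' : y ∈ X.erase x := (List.mem_erase_of_ne hxy.symm).2 hy
  have h2 := List.perm_cons_erase hy'
  have h3 := h1.trans (h2.cons x)
  have hl := h3.length_eq
  match hL : (X.erase x).erase y with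
  | [c, d, e] => exact ⟨c, d, e, (hL ▸ h3).symm⟩
  | [] | [_] | [_, _] | _ :: _ :: _ :: _ :: _ => simp [hL, hX] at hl

theorem eq_of_mem_pathEdges_third {p a b q : V} {R : List V} (hn : (p :: a :: b :: R).Nodup)
    (h : s(b, q) ∈ pathEdges p (a :: b :: R) p) (hqa : q ≠ a) :
    R = [] ∧ q = p ∨ ∃ R', R = q :: R' := by
  simp only [List.nodup_cons, List.mem_cons, not_or] at hn
  cases R with
  | nil =>
    simp only [pathEdges, Multiset.mem_add, Multiset.mem_singleton, Sym2.eq_iff] at h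
    grind
  | cons x R =>
    simp only [pathEdges, Multiset.mem_add, Multiset.mem_singleton, Sym2.eq_iff] at h
    simp only [List.mem_cons, not_or] at hn
    have : s(b, q) ∉ pathEdges x R p := by
      intro hm
      have := mem_of_mem_pathEdges hm (Sym2.mem_mk_left b _)
      grind
    have : q = x := by grind
    exact .inr ⟨R, by rw [this]⟩

namespace CycleDec

variable {k : ℕ} {E : Multiset (Sym2 V)}

/-- One of the closed walks of a decomposition of `E` into `k` closed walks has the edge `ab`,
and the others have the edges `e` and `f`. -/
def HasOdd (k : ℕ) (E : Multiset (Sym2 V)) (a b : V) (e f : Sym2 V) : Prop :=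
  ∃ R k' E', E = pathEdges a (b :: R) a + ({e} + {f} + E') ∧ (a :: b :: R).Nodup ∧
    CycleDec k' ({e} + {f} + E') ∧ k = k' + 1

theorem exists_eq_add {e f : Sym2 V} (hne : e ≠ f) (he : e ∈ E) (hf : f ∈ E) :
    ∃ E', E = {e} + {f} + E' := by
  obtain ⟨E₁, rfl⟩ := Multiset.exists_cons_of_mem he
  obtain ⟨E₂, rfl⟩ := Multiset.exists_cons_of_mem
    ((Multiset.mem_cons.1 hf).resolve_left hne.symm)
  exact ⟨E₂, by simp only [← Multiset.singleton_add]; abel⟩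

theorem HasOdd.mk {a b : V} {e f : Sym2 V} {E' : Multiset (Sym2 V)} {R : List V}
    (hR : (a :: b :: R).Nodup) (h : CycleDec k E') (hne : e ≠ f) (he : e ∈ E') (hf : f ∈ E') :
    HasOdd (k + 1) (pathEdges a (b :: R) a + E') a b e f := by
  obtain ⟨E', rfl⟩ := exists_eq_add hne he hf
  exact ⟨R, k, E', rfl, hR, h, rfl⟩

/-- Three edges lie on the same closed walk, or one of them is on a closed walk without the
other two. -/
theorem same_or_hasOdd {a₁ b₁ a₂ b₂ a₃ b₃ : V} (h : CycleDec k E) (h1 : s(a₁, b₁) ∈ E)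
    (h2 : s(a₂, b₂) ∈ E) (h3 : s(a₃, b₃) ∈ E) (h12 : s(a₁, b₁) ≠ s(a₂, b₂))
    (h13 : s(a₁, b₁) ≠ s(a₃, b₃)) (h23 : s(a₂, b₂) ≠ s(a₃, b₃)) :
    (∃ R k' E', E = pathEdges a₁ (b₁ :: R) a₁ + E' ∧ (a₁ :: b₁ :: R).Nodup ∧ CycleDec k' E' ∧
      k = k' + 1 ∧ s(a₂, b₂) ∈ pathEdges a₁ (b₁ :: R) a₁ ∧
      s(a₃, b₃) ∈ pathEdges a₁ (b₁ :: R) a₁) ∨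
    HasOdd k E a₁ b₁ s(a₂, b₂) s(a₃, b₃) ∨ HasOdd k E a₂ b₂ s(a₁, b₁) s(a₃, b₃) ∨
      HasOdd k E a₃ b₃ s(a₁, b₁) s(a₂, b₂) := by
  obtain ⟨R, k, E, rfl, hR, h', rfl⟩ := h.extract h1
  have hself : s(a₁, b₁) ∈ pathEdges a₁ (b₁ :: R) a₁ := by simp [pathEdges]
  rcases Multiset.mem_add.1 h2 with h4 | h4 <;> rcases Multiset.mem_add.1 h3 with h5 | h5
  · exact .inl ⟨R, k, E, rfl, hR, h', rfl, h4, h5⟩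
  · obtain ⟨R', k, E, rfl, hR', h₀, rfl⟩ := h'.extract h5
    refine .inr (.inr (.inr ?_))
    rw [add_left_comm]
    exact HasOdd.mk hR' (CycleDec.cons _ _ (by simp) hR h₀) h12
      (Multiset.mem_add.2 (.inl hself)) (Multiset.mem_add.2 (.inl h4))
  · obtain ⟨R', k, E, rfl, hR', h₀, rfl⟩ := h'.extract h4
    refine .inr (.inr (.inl ?_))
    rw [add_left_comm]
    exact HasOdd.mk hR' (CycleDec.cons _ _ (by simp) hR h₀) h13
      (Multiset.mem_add.2 (.inl hself)) (Multiset.mem_add.2 (.inl h5))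
  · exact .inr (.inl (HasOdd.mk hR h' h23 h4 h5))

theorem HasOdd.symm {a b : V} {e f : Sym2 V} (h : HasOdd k E a b e f) : HasOdd k E b a e f := by
  obtain ⟨R, k', E', rfl, hR, h, rfl⟩ := h
  obtain ⟨R', h1, h2⟩ := IsCycleThrough.symm ⟨R, rfl, hR⟩
  exact ⟨R', k', E', by rw [h1], h2, h, rfl⟩

theorem HasOdd.comm {a b : V} {e f : Sym2 V} (h : HasOdd k E a b e f) : HasOdd k E a b f e := by
  obtain ⟨R, k', E', rfl, hR, h, rfl⟩ := h
  exact ⟨R, k', E', by rw [add_comm ({e} : Multiset (Sym2 V))], hR, by rwa [add_comm ({f} : Multiset (Sym2 V))], rfl⟩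

variable {u v a b c d e : V}

theorem star_of_hasOdd_triangle (hn : [u, v, a, b, c, d, e].Nodup)
    (hu : Avoids u ({s(a, b)} + {s(b, c)} + {s(c, a)} + E))
    (hv : Avoids v ({s(a, b)} + {s(b, c)} + {s(c, a)} + E))
    (h : HasOdd k ({s(a, b)} + {s(b, c)} + {s(c, a)} + E) a b s(b, c) s(c, a)) :
    CycleDec (k + 1) (starEdges u v a b c d e + E) := by
  obtain ⟨R, k, E', hE, hR, h, rfl⟩ := h
  rw [hE] at hu hv
  refine (star_triangle hn hR h hu hv).congr ?_
  congr 1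
  refine (add_left_cancel (a := {s(a, b)} + {s(b, c)} + {s(c, a)}) ?_).symm
  rw [hE]
  simp only [pathEdges]
  abel

/-- Three pairwise non-adjacent common neighbours. -/
theorem star_of_triangle {x y : V} (hn : [u, v, a, b, c, d, e].Nodup)
    (hu : Avoids u E) (hv : Avoids v E)
    (h : CycleDec k ({s(a, b)} + {s(b, c)} + {s(c, a)} + E)) (hxy : s(x, y) ∈ E)
    (hx : x ∈ [a, b, c, d, e]) (hy : y ∈ [a, b, c, d, e]) (hne : x ≠ y) :
    CycleDec (k + 1) (starEdges u v a b c d e + E) := by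
  have hn' := nodup_seven.1 hn
  have hu' : Avoids u ({s(a, b)} + {s(b, c)} + {s(c, a)} + E) := by
    simp only [avoids_add, avoids_singleton]; tauto
  have hv' : Avoids v ({s(a, b)} + {s(b, c)} + {s(c, a)} + E) := by
    simp only [avoids_add, avoids_singleton]; tauto
  have e1 : ({s(a, b)} + {s(b, c)} + {s(c, a)} + E) =
      {s(b, c)} + {s(c, a)} + {s(a, b)} + E := by abel
  have e2 : ({s(a, b)} + {s(b, c)} + {s(c, a)} + E) =
      {s(c, a)} + {s(a, b)} + {s(b, c)} + E := by abel
  rcases h.same_or_hasOdd (a₁ := a) (b₁ := b) (a₂ := b) (b₂ := c) (a₃ := c) (b₃ := a)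
    (by simp) (by simp) (by simp) (by simp only [ne_eq, Sym2.eq_iff]; grind)
    (by simp only [ne_eq, Sym2.eq_iff]; grind)
    (by simp only [ne_eq, Sym2.eq_iff]; grind) with
    ⟨R, k, E', hE, hR, h', rfl, h2, h3⟩ | h | h | h
  · obtain ⟨R, rfl⟩ := eq_of_mem_pathEdges hR h2 (by grind)
    have hR0 : R = [] := by
      rcases eq_of_mem_pathEdges_third hR h3 (by grind) with ⟨hR, -⟩ | ⟨R', rfl⟩
      · exact hR
      · simp at hR
    subst hR0
    have : E = E' := by
      refine (add_left_cancel (a := {s(a, b)} + {s(b, c)} + {s(c, a)}) ?_)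
      rw [hE]
      simp only [pathEdges]
      abel
    subst this
    obtain ⟨c', d', e', hp⟩ := List.exists_perm_of_mem_mem (by simp) hx hy hne
    rw [← starEdges_perm hp]
    exact star_two_more (((hp.cons v).cons u).nodup_iff.2 hn) h' hu hv hxy
  · exact star_of_hasOdd_triangle hn hu' hv' h
  · rw [e1] at hu' hv' h
    rw [← starEdges_perm (a := b) (b := c) (c := a) (d := d) (e := e) (by
      exact (List.perm_append_comm (l₁ := [b, c]) (l₂ := [a])).append_right [d, e])]
    exact star_of_hasOdd_triangle (by rw [nodup_seven]; clear * - hn'; tauto) hu' hv' h.comm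
  · rw [e2] at hu' hv' h
    rw [← starEdges_perm (a := c) (b := a) (c := b) (d := d) (e := e) (by
      exact (List.perm_append_comm (l₁ := [c]) (l₂ := [a, b])).append_right [d, e])]
    exact star_of_hasOdd_triangle (by rw [nodup_seven]; clear * - hn'; tauto) hu' hv' h

theorem star_of_hasOdd_path (hn : [u, v, a, b, c, d, e].Nodup)
    (hu : Avoids u ({s(a, b)} + {s(b, c)} + {s(c, d)} + E))
    (hv : Avoids v ({s(a, b)} + {s(b, c)} + {s(c, d)} + E))
    (h : HasOdd k ({s(a, b)} + {s(b, c)} + {s(c, d)} + E) a b s(b, c) s(c, d)) :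
    CycleDec (k + 1) (starEdges u v a b c d e + ({s(a, d)} + E)) := by
  obtain ⟨R, k, E', hE, hR, h, rfl⟩ := h
  rw [hE] at hu hv
  refine (star_path_fst (N := []) hn hR h hu hv ?_).congr ?_
  · rw [nodup_seven] at hn
    simp only [List.nodup_cons, List.mem_cons, not_or, List.not_mem_nil, List.nodup_nil,
      not_false_eq_true, and_true]
    clear * - hn
    grind
  rw [add_assoc]
  congr 2
  refine (add_left_cancel (a := {s(a, b)} + {s(b, c)} + {s(c, d)}) ?_).symm
  rw [hE]
  simp only [pathEdges]
  abel

/-- The edge `ad` with the path `abcd` in the complement. -/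
theorem star_of_path {y : V} (hn : [u, v, a, b, c, d, e].Nodup)
    (hu : Avoids u ({s(a, d)} + E)) (hv : Avoids v ({s(a, d)} + E))
    (h : CycleDec k ({s(a, b)} + {s(b, c)} + {s(c, d)} + E)) (hby : s(b, y) ∈ E)
    (hy : y ∈ [a, b, c, d, e]) :
    CycleDec (k + 1) (starEdges u v a b c d e + ({s(a, d)} + E)) := by
  have hn' := nodup_seven.1 hn
  have hu' : Avoids u ({s(a, b)} + {s(b, c)} + {s(c, d)} + E) := by
    simp only [avoids_add, avoids_singleton] at hu ⊢; tauto
  have hv' : Avoids v ({s(a, b)} + {s(b, c)} + {s(c, d)} + E) := by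
    simp only [avoids_add, avoids_singleton] at hv ⊢; tauto
  rcases h.same_or_hasOdd (a₁ := a) (b₁ := b) (a₂ := b) (b₂ := c) (a₃ := c) (b₃ := d)
    (by simp) (by simp) (by simp) (by simp only [ne_eq, Sym2.eq_iff]; grind)
    (by simp only [ne_eq, Sym2.eq_iff]; grind)
    (by simp only [ne_eq, Sym2.eq_iff]; grind) with
    ⟨R, k, E', hE, hR, h', rfl, h2, h3⟩ | h | h | h
  · obtain ⟨R, rfl⟩ := eq_of_mem_pathEdges hR h2 (by grind)
    obtain ⟨R, rfl⟩ : ∃ R', R = d :: R' := by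
      rcases eq_of_mem_pathEdges_third hR h3 (by grind) with ⟨-, hR⟩ | hR
      · grind
      · exact hR
    have hEE : E = pathEdges d R a + E' := by
      refine (add_left_cancel (a := {s(a, b)} + {s(b, c)} + {s(c, d)}) ?_)
      rw [hE]
      simp only [pathEdges]
      abel
    have hEE' : {s(a, d)} + E = pathEdges a (d :: R) a + E' := by
      rw [hEE]
      simp only [pathEdges]
      abel
    have hbE : s(b, y) ∈ E' := by
      rw [hEE] at hby
      refine (Multiset.mem_add.1 hby).resolve_left fun hm ↦ ?_
      have := mem_of_mem_pathEdges hm (Sym2.mem_mk_left b _)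
      simp only [List.nodup_cons, List.mem_cons, not_or] at hR
      grind
    rw [hEE'] at hu hv ⊢
    have hp : [a, d, b, c, e].Perm [a, b, c, d, e] :=
      ((List.perm_append_comm (l₁ := [d]) (l₂ := [b, c])).append_right [e]).cons a
    rw [← starEdges_perm hp]
    refine star_of_two_edges (x := b) (y := y) (((hp.cons v).cons u).nodup_iff.2 hn)
      ⟨R, rfl, ?_⟩ h' hu hv hbE ?_ (by simp) (hp.mem_iff.2 hy)
    · simp only [List.nodup_cons, List.mem_cons, not_or] at hR ⊢
      tauto
    · simp only [ne_eq, Sym2.eq_iff]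
      grind
  · exact star_of_hasOdd_path hn hu' hv' h
  · obtain ⟨R, k, E', hE, hR, h₀, rfl⟩ := h.comm
    rw [hE] at hu' hv'
    refine (star_path_snd (N := []) hn hR h₀ hu' hv' ?_).congr ?_
    · simp only [List.nodup_cons, List.mem_cons, not_or, List.not_mem_nil, List.nodup_nil,
        not_false_eq_true, and_true]
      clear * - hn'
      grind
    rw [add_assoc]
    congr 2
    refine (add_left_cancel (a := {s(a, b)} + {s(b, c)} + {s(c, d)}) ?_).symm
    rw [hE]
    simp only [pathEdges]
    abel
  · have e1 : ({s(a, b)} + {s(b, c)} + {s(c, d)} + E) =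
      {s(d, c)} + {s(c, b)} + {s(b, a)} + E := by
      simp only [Sym2.eq_swap]
      abel
    have hs := h.symm.comm
    rw [Sym2.eq_swap (a := b), Sym2.eq_swap (a := a) (b := b)] at hs
    rw [e1] at hu' hv'
    have hp : [d, c, b, a, e].Perm [a, b, c, d, e] :=
      (List.reverse_perm [a, b, c, d]).append_right [e]
    rw [← starEdges_perm hp, Sym2.eq_swap (a := a) (b := d)]
    refine star_of_hasOdd_path (((hp.cons v).cons u).nodup_iff.2 hn) hu' hv' ?_
    convert hs using 1
    simp only [Sym2.eq_swap]
    abel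

end CycleDec

end CommonNeighbours

section EvenDegrees

variable {V : Type}

open Classical in
/-- Every vertex is incident with an even number of edges of `E`. -/
def EvenDegrees (E : Multiset (Sym2 V)) : Prop := ∀ x, Even (E.countP fun e ↦ x ∈ e)

theorem EvenDegrees.add {E F : Multiset (Sym2 V)} (hE : EvenDegrees E) (hF : EvenDegrees F) :
    EvenDegrees (E + F) := fun x ↦ by
  rw [Multiset.countP_add]
  exact (hE x).add (hF x)

theorem EvenDegrees.of_add {E F : Multiset (Sym2 V)} (hE : EvenDegrees (E + F))
    (hF : EvenDegrees F) : EvenDegrees E := fun x ↦ by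
  have := hE x
  rw [Multiset.countP_add] at this
  exact (Nat.even_add.1 this).2 (hF x)

theorem evenDegrees_triangle {a b c : V} (hab : a ≠ b) (hbc : b ≠ c) (hca : c ≠ a) :
    EvenDegrees ({s(a, b)} + {s(b, c)} + {s(c, a)} : Multiset (Sym2 V)) := by
  classical
  intro x
  simp only [Multiset.countP_add, ← Multiset.cons_zero, Multiset.countP_cons, Sym2.mem_iff,
    Multiset.countP_zero]
  by_cases h1 : x = a <;> by_cases h2 : x = b <;> by_cases h3 : x = c <;> simp_all

theorem evenDegrees_square {a b c d : V} (hab : a ≠ b) (hac : a ≠ c) (had : a ≠ d) (hbc : b ≠ c)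
    (hbd : b ≠ d) (hcd : c ≠ d) :
    EvenDegrees ({s(a, b)} + {s(b, c)} + {s(c, d)} + {s(a, d)} : Multiset (Sym2 V)) := by
  classical
  intro x
  simp only [Multiset.countP_add, ← Multiset.cons_zero, Multiset.countP_cons, Sym2.mem_iff,
    Multiset.countP_zero]
  by_cases h1 : x = a <;> by_cases h2 : x = b <;> by_cases h3 : x = c <;> by_cases h4 : x = d <;>
    simp_all

/-- Every set of edges with even degrees off `u` and `v` decomposes into `K` closed walks. -/
def DecomposableOff (u v : V) (K : ℕ) : Prop :=
  ∀ E : Multiset (Sym2 V), E.Nodup → (∀ e ∈ E, ¬ e.IsDiag) → Avoids u E → Avoids v E →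
    EvenDegrees E → CycleDec K E

structure EvenOff (u v : V) (E : Multiset (Sym2 V)) : Prop where
  nodup : E.Nodup
  notDiag : ∀ e ∈ E, ¬ e.IsDiag
  avoids_fst : Avoids u E
  avoids_snd : Avoids v E
  even : EvenDegrees E

variable {u v a b c d e : V} {K : ℕ} {E : Multiset (Sym2 V)}

namespace CycleDec

theorem star_of_isolated_triangle {x y : V} (hdec : DecomposableOff u v K) (hE : EvenOff u v E)
    (hn : [u, v, a, b, c, d, e].Nodup) (hab : s(a, b) ∉ E) (hbc : s(b, c) ∉ E) (hca : s(c, a) ∉ E)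
    (hxy : s(x, y) ∈ E) (hx : x ∈ [a, b, c, d, e]) (hy : y ∈ [a, b, c, d, e]) :
    CycleDec (K + 1) (starEdges u v a b c d e + E) := by
  have hn' := nodup_seven.1 hn
  refine star_of_triangle (x := x) (y := y) hn hE.avoids_fst hE.avoids_snd (hdec _ ?_ ?_ ?_ ?_ ?_)
    hxy hx hy (by simpa using hE.notDiag _ hxy)
  · simp only [Multiset.singleton_add, Multiset.cons_add, Multiset.nodup_cons, Multiset.mem_cons,
      Sym2.eq_iff]
    have := hE.nodup
    clear * - hn' this hab hbc hca
    grind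
  · have := hE.notDiag
    simp only [Multiset.singleton_add, Multiset.cons_add, Multiset.mem_cons, forall_eq_or_imp,
      Sym2.mk_isDiag_iff]
    tauto
  · have := hE.avoids_fst
    simp only [avoids_add, avoids_singleton]; tauto
  · have := hE.avoids_snd
    simp only [avoids_add, avoids_singleton]; tauto
  · exact (evenDegrees_triangle hn'.2.2.1.1 hn'.2.2.2.1.1 hn'.2.2.1.2.1.symm).add hE.even

theorem star_of_isolated_path {y : V} (hdec : DecomposableOff u v K) (hE : EvenOff u v E)
    (hn : [u, v, a, b, c, d, e].Nodup) (had : s(a, d) ∈ E) (hab : s(a, b) ∉ E) (hbc : s(b, c) ∉ E)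
    (hcd : s(c, d) ∉ E) (hby : s(b, y) ∈ E) (hy : y ∈ [a, b, c, d, e]) :
    CycleDec (K + 1) (starEdges u v a b c d e + E) := by
  have hn' := nodup_seven.1 hn
  obtain ⟨h1, h2, h3, h4, h5⟩ := hE
  obtain ⟨E, rfl⟩ := Multiset.exists_cons_of_mem had
  rw [← Multiset.singleton_add] at *
  have hya : y ≠ a := by rintro rfl; rw [Sym2.eq_swap (a := y) (b := b)] at hab; exact hab hby
  have hyc : y ≠ c := by rintro rfl; exact hbc hby
  simp only [Multiset.singleton_add, Multiset.nodup_cons, Multiset.mem_cons, not_or,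
    forall_eq_or_imp, Sym2.mk_isDiag_iff] at h1 h2 hab hbc hcd hby
  refine star_of_path (y := y) hn h3 h4 (hdec _ ?_ ?_ ?_ ?_ ?_) (hby.resolve_left ?_) hy
  · simp only [Multiset.singleton_add, Multiset.cons_add, Multiset.nodup_cons, Multiset.mem_cons,
      Sym2.eq_iff]
    clear * - hn' h1 hab hbc hcd
    grind
  · simp only [Multiset.singleton_add, Multiset.cons_add, Multiset.mem_cons, forall_eq_or_imp,
      Sym2.mk_isDiag_iff]
    tauto
  · simp only [avoids_add, avoids_singleton] at h3 ⊢; tauto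
  · simp only [avoids_add, avoids_singleton] at h4 ⊢; tauto
  · have hsq := (evenDegrees_square hn'.2.2.1.1 hn'.2.2.1.2.1 hn'.2.2.1.2.2.1 hn'.2.2.2.1.1
      hn'.2.2.2.1.2.1 hn'.2.2.2.2.1.1).add h5
    have had : EvenDegrees ({s(a, d)} + {s(a, d)} : Multiset (Sym2 V)) := fun x ↦ by
      rw [Multiset.countP_add]
      exact ⟨_, rfl⟩
    refine EvenDegrees.of_add (F := {s(a, d)} + {s(a, d)}) ?_ had
    convert hsq using 1
    abel
  · simp only [Sym2.eq_iff]
    clear * - hn' hya hyc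
    grind

theorem star_of_degree_three (hdec : DecomposableOff u v K) (hE : EvenOff u v E)
    (hn : [u, v, a, b, c, d, e].Nodup) (hab : s(a, b) ∈ E) (hac : s(a, c) ∈ E) (had : s(a, d) ∈ E) :
    CycleDec (K + 1) (starEdges u v a b c d e + E) := by
  have hn' := nodup_seven.1 hn
  have hu := hE.avoids_fst
  have hv := hE.avoids_snd
  obtain ⟨R, k, E, rfl, hR, h, rfl⟩ :=
    (hdec E hE.nodup hE.notDiag hu hv hE.even).extract (Sym2.eq_swap ▸ hab : s(b, a) ∈ E)
  have hF : IsCycleThrough (pathEdges b (a :: R) b) a b := IsCycleThrough.symm ⟨R, rfl, hR⟩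
  rcases Multiset.mem_add.1 hac with h1 | h1
  swap
  · exact star_of_two_edges hn hF h hu hv h1 (by simp only [ne_eq, Sym2.eq_iff]; grind) (by simp)
      (by simp)
  rcases Multiset.mem_add.1 had with h2 | h2
  swap
  · exact star_of_two_edges hn hF h hu hv h2 (by simp only [ne_eq, Sym2.eq_iff]; grind) (by simp)
      (by simp)
  obtain ⟨R₁, rfl⟩ := eq_of_mem_pathEdges hR h1 (by grind)
  obtain ⟨R₂, hR₂⟩ := eq_of_mem_pathEdges hR h2 (by grind)
  grind

theorem star_of_triangle_edge {x y : V} (hdec : DecomposableOff u v K) (hE : EvenOff u v E)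
    (hn : [u, v, a, b, c, d, e].Nodup) (hab : s(a, b) ∈ E) (hbc : s(b, c) ∈ E) (hca : s(c, a) ∈ E)
    (hxy : s(x, y) ∈ E) (hx : x ∈ [a, b, c, d, e]) (hy : y ∈ [a, b, c, d, e]) 
    (hx' : x = d ∨ x = e) :
    CycleDec (K + 1) (starEdges u v a b c d e + E) := by
  have hn' := nodup_seven.1 hn
  have hu := hE.avoids_fst
  have hv := hE.avoids_snd
  have hnd := hE.nodup
  obtain ⟨R, k, E, rfl, hR, h, rfl⟩ :=
    (hdec E hE.nodup hE.notDiag hu hv hE.even).extract hab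
  have hF : IsCycleThrough (pathEdges a (b :: R) a) a b := ⟨R, rfl, hR⟩
  rcases Multiset.mem_add.1 hbc with h1 | h1
  swap
  · exact star_of_two_edges hn hF h hu hv h1 (by simp only [ne_eq, Sym2.eq_iff]; grind) (by simp)
      (by simp)
  rcases Multiset.mem_add.1 hca with h2 | h2
  swap
  · exact star_of_two_edges hn hF h hu hv h2 (by simp only [ne_eq, Sym2.eq_iff]; grind) (by simp)
      (by simp)
  obtain ⟨R, rfl⟩ := eq_of_mem_pathEdges hR h1 (by grind)
  have hR0 : R = [] := by
    rcases eq_of_mem_pathEdges_third hR h2 (by grind) with ⟨hR, -⟩ | ⟨R', rfl⟩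
    · exact hR
    · simp at hR
  subst hR0
  rcases Multiset.mem_add.1 hxy with h3 | h3
  · have := mem_of_mem_pathEdges h3 (Sym2.mem_mk_left x _)
    simp only [List.mem_cons, List.not_mem_nil] at this
    grind
  · exact star_of_two_edges hn hF h hu hv h3 (by simp only [ne_eq, Sym2.eq_iff]; grind) hx hy

open Classical in
theorem perm_of_count {x₁ x₂ x₃ x₄ x₅ y₁ y₂ y₃ y₄ y₅ : V}
    (h : ∀ z : V → ℕ, z x₁ + z x₂ + z x₃ + z x₄ + z x₅ = z y₁ + z y₂ + z y₃ + z y₄ + z y₅) :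
    [x₁, x₂, x₃, x₄, x₅].Perm [y₁, y₂, y₃, y₄, y₅] := by
  refine List.perm_iff_count.2 fun t ↦ ?_
  have := h fun s ↦ if s = t then 1 else 0
  simp only [List.count_cons, List.count_nil, beq_iff_eq]
  omega

/-- If two of the common neighbours are adjacent, then the star edges only need one more closed
walk. -/
theorem star_of_mem_edge (hdec : DecomposableOff u v K) (hE : EvenOff u v E)
    (hn : [u, v, a, b, c, d, e].Nodup) (hab : s(a, b) ∈ E) :
    CycleDec (K + 1) (starEdges u v a b c d e + E) := by
  by_contra hcon
  have hN : ∀ {x₁ x₂ x₃ x₄ x₅}, [x₁, x₂, x₃, x₄, x₅].Perm [a, b, c, d, e] →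
      [u, v, x₁, x₂, x₃, x₄, x₅].Nodup := fun hp ↦ ((hp.cons v).cons u).nodup_iff.2 hn
  have sw : ∀ {x y}, s(x, y) ∈ E → s(y, x) ∈ E := fun h ↦ Sym2.eq_swap ▸ h
  have hT : ∀ x₁ x₂ x₃ x₄ x₅, [x₁, x₂, x₃, x₄, x₅].Perm [a, b, c, d, e] →
      s(x₁, x₂) ∈ E ∨ s(x₂, x₃) ∈ E ∨ s(x₃, x₁) ∈ E := by
    intro x₁ x₂ x₃ x₄ x₅ hp
    by_contra! h
    refine hcon (starEdges_perm hp ▸ ?_)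
    exact star_of_isolated_triangle hdec hE (hN hp) h.1 h.2.1 h.2.2 hab (hp.mem_iff.2 (by simp))
      (hp.mem_iff.2 (by simp))
  have hP : ∀ x₁ x₂ x₃ x₄ x₅ y, [x₁, x₂, x₃, x₄, x₅].Perm [a, b, c, d, e] →
      s(x₁, x₄) ∈ E → s(x₂, y) ∈ E → y ∈ [a, b, c, d, e] →
      s(x₁, x₂) ∈ E ∨ s(x₂, x₃) ∈ E ∨ s(x₃, x₄) ∈ E := by
    intro x₁ x₂ x₃ x₄ x₅ y hp h1 h2 hy
    by_contra! h
    refine hcon (starEdges_perm hp ▸ ?_)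
    exact star_of_isolated_path hdec hE (hN hp) h1 h.1 h.2.1 h.2.2 h2 (hp.mem_iff.2 hy)
  have hD : ∀ x₁ x₂ x₃ x₄ x₅, [x₁, x₂, x₃, x₄, x₅].Perm [a, b, c, d, e] →
      s(x₁, x₂) ∈ E → s(x₁, x₃) ∈ E → s(x₁, x₄) ∉ E := by
    intro x₁ x₂ x₃ x₄ x₅ hp h1 h2 h3
    refine hcon (starEdges_perm hp ▸ ?_)
    exact star_of_degree_three hdec hE (hN hp) h1 h2 h3
  have hC : ∀ x₁ x₂ x₃ x₄ x₅ y, [x₁, x₂, x₃, x₄, x₅].Perm [a, b, c, d, e] →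
      s(x₁, x₂) ∈ E → s(x₂, x₃) ∈ E → s(x₃, x₁) ∈ E → y ∈ [a, b, c, d, e] → s(x₄, y) ∉ E := by
    intro x₁ x₂ x₃ x₄ x₅ y hp h1 h2 h3 hy h4
    refine hcon (starEdges_perm hp ▸ ?_)
    exact star_of_triangle_edge hdec hE (hN hp) h1 h2 h3 h4 (by simp) (hp.mem_iff.2 hy) (.inl rfl)
  have key : ∀ x y p q r, [x, y, p, q, r].Perm [a, b, c, d, e] → s(x, y) ∈ E → s(x, p) ∈ E →
      s(y, q) ∉ E := by
    intro x y p q r hp hxy hxp hyq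
    have hq : q ∈ [a, b, c, d, e] := hp.mem_iff.1 (by simp)
    have hr : r ∈ [a, b, c, d, e] := hp.mem_iff.1 (by simp)
    have hxq := hD x y p q r hp hxy hxp
    have hxr := hD x y p r q (.trans (perm_of_count fun z ↦ by omega) hp) hxy hxp
    have hyr := hD y x q r p (.trans (perm_of_count fun z ↦ by omega) hp) (sw hxy) hyq
    have hyp : s(p, y) ∉ E := fun h ↦
      hC x y p q r y hp hxy (sw h) (sw hxp) (hp.mem_iff.1 (by simp)) (sw hyq)
    have hqr := hT x q r y p (.trans (perm_of_count fun z ↦ by omega) hp)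
    have hpr := hT y p r x q (.trans (perm_of_count fun z ↦ by omega) hp)
    have hqp : s(q, p) ∉ E := fun h ↦
      hC p q r x y y (.trans (perm_of_count fun z ↦ by omega) hp) (sw h) (by grind) (by grind)
        (hp.mem_iff.1 (by simp)) hxy
    have := hP x q p y r r (.trans (perm_of_count fun z ↦ by omega) hp) hxy (by grind) hr
    tauto
  have key' : ∀ x y p q r, [x, y, p, q, r].Perm [a, b, c, d, e] → s(x, y) ∈ E →
      s(x, p) ∉ E := by
    intro x y p q r hp hxy hxp
    have hyq := key x y p q r hp hxy hxp
    have hyr := key x y p r q (.trans (perm_of_count fun z ↦ by omega) hp) hxy hxp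
    have hxq := hD x y p q r hp hxy hxp
    have hxr := hD x y p r q (.trans (perm_of_count fun z ↦ by omega) hp) hxy hxp
    have hqr := hT x q r y p (.trans (perm_of_count fun z ↦ by omega) hp)
    have hyp : s(y, p) ∉ E := fun h ↦
      hC x y p q r r hp hxy h (sw hxp) (hp.mem_iff.1 (by simp)) (by grind)
    have h1 := hT y p q x r (.trans (perm_of_count fun z ↦ by omega) hp)
    have h2 := hT y p r x q (.trans (perm_of_count fun z ↦ by omega) hp)
    exact hC p q r x y y (.trans (perm_of_count fun z ↦ by omega) hp) (by grind) (by grind) (by grind)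
      (hp.mem_iff.1 (by simp)) hxy
  have hac := key' a b c d e (.refl _) hab
  have had := key' a b d c e (perm_of_count fun z ↦ by omega) hab
  have hae := key' a b e c d (perm_of_count fun z ↦ by omega) hab
  have h1 := hT a c d b e (perm_of_count fun z ↦ by omega)
  have h2 := hT a c e b d (perm_of_count fun z ↦ by omega)
  have h3 := hT a d e b c (perm_of_count fun z ↦ by omega)
  exact hC c d e a b b (perm_of_count fun z ↦ by omega) (by grind) (by grind) (by grind) (by simp) hab

end CycleDec

end EvenDegrees

section Walks

variable {V : Type}

theorem exists_list_of_walk {G : SimpleGraph V} {a b : V} (p : G.Walk a b) (hp : p.edges ≠ []) :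
    ∃ l, p.support = a :: (l ++ [b]) ∧ (p.edges : Multiset (Sym2 V)) = pathEdges a l b := by
  induction p with
  | nil => simp at hp
  | @cons a c b h p ih =>
    by_cases hp : p.edges = []
    · cases p with
      | nil => exact ⟨[], by simp, by simp [pathEdges]⟩
      | cons h' p => simp at hp
    · obtain ⟨l, h1, h2⟩ := ih hp
      refine ⟨c :: l, by simp [h1], ?_⟩
      rw [SimpleGraph.Walk.edges_cons, ← Multiset.cons_coe, h2, pathEdges, Multiset.singleton_add]

theorem exists_list_of_isCycle {G : SimpleGraph V} {a : V} {p : G.Walk a a} (hp : p.IsCycle) :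
    ∃ l, l ≠ [] ∧ (a :: l).Nodup ∧ (p.edges : Multiset (Sym2 V)) = pathEdges a l a := by
  have h3 := hp.three_le_length
  obtain ⟨l, h1, h2⟩ := exists_list_of_walk p (by
    intro h
    have := p.length_edges
    rw [h, List.length_nil] at this
    omega)
  refine ⟨l, ?_, ?_, h2⟩
  · rintro rfl
    have := p.length_support
    rw [h1] at this
    simp at this
    omega
  · have := hp.support_nodup
    rw [h1, List.tail_cons] at this
    exact (List.perm_append_comm (l₁ := [a])).nodup_iff.2 this

theorem exists_walk_of_list {G : SimpleGraph V} {a b : V} {l : List V}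
    (h : ∀ e ∈ pathEdges a l b, e ∈ G.edgeSet) :
    ∃ p : G.Walk a b, p.support = a :: (l ++ [b]) ∧
      (p.edges : Multiset (Sym2 V)) = pathEdges a l b := by
  induction l generalizing a with
  | nil =>
    have hab : G.Adj a b := h s(a, b) (by simp [pathEdges])
    exact ⟨.cons hab .nil, by simp, by simp [pathEdges]⟩
  | cons c l ih =>
    have hac : G.Adj a c := h s(a, c) (by simp [pathEdges])
    obtain ⟨p, h1, h2⟩ := ih (a := c) fun e he ↦ h e (by simp [pathEdges, he])
    refine ⟨.cons hac p, by simp [h1], ?_⟩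
    rw [SimpleGraph.Walk.edges_cons, ← Multiset.cons_coe, h2, pathEdges, Multiset.singleton_add]

theorem exists_cycle_of_list {G : SimpleGraph V} {a : V} {l : List V}
    (h : ∀ e ∈ pathEdges a l a, e ∈ G.edgeSet) (hn : (a :: l).Nodup)
    (hE : (pathEdges a l a).Nodup) :
    ∃ p : G.Walk a a, p.IsCycle ∧ (p.edges : Multiset (Sym2 V)) = pathEdges a l a := by
  obtain ⟨p, h1, h2⟩ := exists_walk_of_list h
  refine ⟨p, SimpleGraph.Walk.isCycle_def _ |>.2 ⟨⟨?_⟩, ?_, ?_⟩, h2⟩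
  · rwa [← h2, Multiset.coe_nodup] at hE
  · rintro rfl
    simp at h1
  · rw [h1, List.tail_cons]
    exact (List.perm_append_comm (l₁ := [a])).nodup_iff.1 hn

theorem pathEdges_map {W : Type} (f : W → V) (a : W) (l : List W) (b : W) :
    (pathEdges a l b).map (Sym2.map f) = pathEdges (f a) (l.map f) (f b) := by
  induction l generalizing a with
  | nil => simp [pathEdges]
  | cons c l ih => simp [pathEdges, ih]

theorem CycleDec.exists_cycles {G : SimpleGraph V} {m : ℕ} {E : Multiset (Sym2 V)}
    (h : CycleDec m E) (hE : E.Nodup) (hG : ∀ e ∈ E, e ∈ G.edgeSet) :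
    ∃ m' ≤ m, ∃ D : Fin m' → Σ b, G.Walk b b, (∀ i, (D i).2.IsCycle) ∧
      (∀ i j, i ≠ j → ∀ e, e ∈ (D i).2.edges → e ∉ (D j).2.edges) ∧
      ∀ e, e ∈ E ↔ ∃ i, e ∈ (D i).2.edges := by
  induction h with
  | zero m => exact ⟨0, by simp, fun i ↦ i.elim0, fun i ↦ i.elim0, fun i ↦ i.elim0, by simp⟩
  | @cons m E a l hl hn h ih =>
    obtain ⟨h1, h2, h3⟩ := Multiset.nodup_add.1 hE
    obtain ⟨m', hm, D, hD1, hD2, hD3⟩ := ih h2 fun e he ↦ hG e (Multiset.mem_add.2 (.inr he))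
    obtain ⟨p, hp, hpE⟩ := exists_cycle_of_list
      (fun e he ↦ hG e (Multiset.mem_add.2 (.inl he))) hn h1
    have hmem : ∀ e, e ∈ p.edges ↔ e ∈ pathEdges a l a := fun e ↦ by rw [← hpE, Multiset.mem_coe]
    have hdis : ∀ e i, e ∈ p.edges → e ∉ (D i).2.edges := fun e i he he' ↦
      Multiset.disjoint_left.1 h3 ((hmem e).1 he) ((hD3 e).2 ⟨i, he'⟩)
    refine ⟨m' + 1, by omega, Fin.cons ⟨a, p⟩ D, fun i ↦ ?_, fun i j hij e ↦ ?_, fun e ↦ ?_⟩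
    · cases i using Fin.cases with
      | zero => exact hp
      | succ i => exact hD1 i
    · cases i using Fin.cases with
      | zero =>
        cases j using Fin.cases with
        | zero => exact absurd rfl hij
        | succ j => exact hdis e j
      | succ i =>
        cases j using Fin.cases with
        | zero => exact fun h1 h2 ↦ hdis e i h2 h1
        | succ j => exact hD2 i j (fun h ↦ hij (h ▸ rfl)) e
    · rw [Multiset.mem_add, Fin.exists_fin_succ, ← hmem, hD3]
      rfl

theorem CycleDec.fulfilsHajos [Fintype V] {G : SimpleGraph V} {E : Multiset (Sym2 V)}
    (h : CycleDec ((Fintype.card V - 1) / 2) E) (hE : E.Nodup) (hG : ∀ e, e ∈ E ↔ e ∈ G.edgeSet) :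
    FulfilsHajos G := by
  obtain ⟨m, hm, D, h1, h2, h3⟩ := h.exists_cycles hE fun e ↦ (hG e).1
  exact ⟨m, fun i ↦ (D i).1, fun i ↦ (D i).2, hm, h1, h2, fun e ↦ by rw [← hG, h3]⟩

theorem cycleDec_sum {W : Type} {H : SimpleGraph W} (f : W → V) (hf : f.Injective) (m : ℕ)
    (B : Fin m → W) (c : (i : Fin m) → H.Walk (B i) (B i)) (hc : ∀ i, (c i).IsCycle) :
    CycleDec m (∑ i, ((c i).edges : Multiset (Sym2 W)).map (Sym2.map f)) := by
  induction m with
  | zero => exact CycleDec.zero 0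
  | succ m ih =>
    rw [Fin.sum_univ_succ]
    obtain ⟨l, hl, hn, h⟩ := exists_list_of_isCycle (hc 0)
    rw [h, pathEdges_map]
    exact CycleDec.cons _ _ (by simpa using hl) (by simpa using hn.map hf) (ih _ _ fun i ↦ hc _)

theorem FulfilsHajos.cycleDec {W : Type} [Fintype W] {H : SimpleGraph W} (h : FulfilsHajos H)
    (f : W → V) (hf : f.Injective) {E : Multiset (Sym2 V)} (hE : E.Nodup)
    (hEH : ∀ e, e ∈ E ↔ ∃ e' ∈ H.edgeSet, Sym2.map f e' = e) :
    CycleDec ((Fintype.card W - 1) / 2) E := by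
  classical
  obtain ⟨m, B, c, hm, hc, hd, hH⟩ := h
  refine (cycleDec_sum f hf m B c hc).mono hm |>.congr ?_
  refine (Multiset.Nodup.ext ?_ hE).2 fun e ↦ ?_
  · refine Multiset.nodup_iff_count_le_one.2 fun e ↦ ?_
    have hcount : ∀ i, (((c i).edges : Multiset (Sym2 W)).map (Sym2.map f)).Nodup := fun i ↦
      Multiset.Nodup.map (Sym2.map.injective hf) (hc i).edges_nodup
    rw [Multiset.count_sum']
    by_cases he : ∃ i, e ∈ ((c i).edges : Multiset (Sym2 W)).map (Sym2.map f)
    · obtain ⟨i, hi⟩ := he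
      rw [Finset.sum_eq_single i]
      · exact Multiset.nodup_iff_count_le_one.1 (hcount i) e
      · intro j _ hji
        refine Multiset.count_eq_zero.2 fun hj ↦ ?_
        obtain ⟨e₁, h1, rfl⟩ := Multiset.mem_map.1 hi
        obtain ⟨e₂, h2, h3⟩ := Multiset.mem_map.1 hj
        obtain rfl := Sym2.map.injective hf h3
        exact hd j i hji _ h2 h1
      · simp
    · refine (Finset.sum_eq_zero fun i _ ↦ ?_).trans_le zero_le_one
      exact Multiset.count_eq_zero.2 fun hi ↦ he ⟨i, hi⟩
  · rw [hEH, Multiset.mem_sum]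
    simp only [Finset.mem_univ, true_and, Multiset.mem_map, Multiset.mem_coe, hH]
    tauto

end Walks

section Decompositions

variable {V : Type}

/-- The graph whose edges are the edges of `E` among the vertices in `S`. -/
def graphOn (E : Multiset (Sym2 V)) (S : Set V) : SimpleGraph S :=
  (SimpleGraph.fromEdgeSet {e | e ∈ E}).induce S

theorem graphOn_adj {E : Multiset (Sym2 V)} {S : Set V} (hd : ∀ e ∈ E, ¬ e.IsDiag) {x y : S} :
    (graphOn E S).Adj x y ↔ s((x : V), (y : V)) ∈ E := by
  simp only [graphOn, SimpleGraph.comap_adj, SimpleGraph.fromEdgeSet_adj, Set.mem_ofPred_eq,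
    Function.Embedding.subtype_apply, and_iff_left_iff_imp]
  intro h
  simpa using hd _ h

open Classical in
theorem ncard_neighborSet {W : Type} {H : SimpleGraph W} {f : W → V} (hf : f.Injective)
    {E : Multiset (Sym2 V)} (hE : E.Nodup) (x : W)
    (h : ∀ e, e ∈ E ∧ f x ∈ e ↔ ∃ y, H.Adj x y ∧ s(f x, f y) = e) :
    (H.neighborSet x).ncard = E.countP fun e ↦ f x ∈ e := by
  have hinj : Function.Injective fun y ↦ s(f x, f y) := fun y z hyz ↦
    hf (Sym2.congr_right.1 hyz)
  rw [← Set.ncard_image_of_injective _ hinj, Multiset.countP_eq_card_filter]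
  have : (fun y ↦ s(f x, f y)) '' H.neighborSet x =
      ((⟨E.filter fun e ↦ f x ∈ e, hE.filter _⟩ : Finset (Sym2 V)) : Set (Sym2 V)) := by
    ext e
    simp only [Set.mem_image, SimpleGraph.mem_neighborSet, Finset.mem_coe, Finset.mem_mk,
      Multiset.mem_filter, h]
  rw [this, Set.ncard_coe_finset]
  rfl

/-- All Eulerian graphs with fewer than `n` vertices fulfil the conjecture. -/
def HajosBelow (n : ℕ) : Prop :=
  ∀ (W : Type) [Fintype W] (H : SimpleGraph W), Fintype.card W < n → IsEulerian H → FulfilsHajos H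

theorem cycleDec_of_evenDegrees {n : ℕ} (hn : HajosBelow n) (S : Finset V)
    (hS : S.card < n) {E : Multiset (Sym2 V)} (hE : E.Nodup) (hd : ∀ e ∈ E, ¬ e.IsDiag)
    (hES : ∀ e ∈ E, ∀ x ∈ e, x ∈ S) (hev : EvenDegrees E) :
    CycleDec ((S.card - 1) / 2) E := by
  classical
  induction hs : S.card using Nat.strong_induction_on generalizing S E with
  | _ s ih =>
  subst hs
  have hadj : ∀ {x y : (S : Set V)}, (graphOn E S).Adj x y ↔ s((x : V), (y : V)) ∈ E :=
    graphOn_adj hd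
  by_cases hcon : (graphOn E S).Connected
  · have hH : FulfilsHajos (graphOn E S) := by
      refine hn _ _ (by simpa using hS) ⟨hcon, fun x ↦ ?_⟩
      rw [ncard_neighborSet (f := fun x : (S : Set V) ↦ (x : V)) Subtype.val_injective hE x]
      · exact hev x
      · intro e
        constructor
        · rintro ⟨he, y, rfl⟩
          exact ⟨⟨y, hES _ he y (by simp)⟩, hadj.2 he, rfl⟩
        · rintro ⟨y, hy, rfl⟩
          exact ⟨hadj.1 hy, by simp⟩
    have := hH.cycleDec (fun x : (S : Set V) ↦ (x : V)) Subtype.val_injective hE fun e ↦ by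
      constructor
      · intro he
        induction e with
        | _ x y =>
          exact ⟨s(⟨x, hES _ he x (by simp)⟩, ⟨y, hES _ he y (by simp)⟩), hadj.2 he, rfl⟩
      · rintro ⟨e, he, rfl⟩
        induction e with
        | _ x y => exact hadj.1 he
    simpa using this
  rcases S.eq_empty_or_nonempty with rfl | ⟨r, hr⟩
  · have : E = 0 := by
      refine Multiset.eq_zero_of_forall_notMem fun e he ↦ ?_
      induction e with
      | _ x y => simpa using hES _ he x (by simp)
    rw [this]
    exact .zero _
  have : ∃ x y, ¬ (graphOn E S).Reachable x y := by
    by_contra! h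
    exact hcon ((SimpleGraph.connected_iff _).2 ⟨h, ⟨⟨r, hr⟩⟩⟩)
  obtain ⟨x, y, hxy⟩ := this
  set T := S.filter fun z ↦ ∃ h : z ∈ S, (graphOn E S).Reachable x ⟨z, h⟩ with hTdef
  have hT : ∀ p q, s(p, q) ∈ E → p ∈ T → q ∈ T := by
    intro p q hpq hp
    obtain ⟨hpS, hp⟩ := (Finset.mem_filter.1 hp).2
    have hqS := hES _ hpq q (by simp)
    have hpq' : (graphOn E S).Adj ⟨p, hpS⟩ ⟨q, hqS⟩ := hadj.2 hpq
    exact Finset.mem_filter.2 ⟨hqS, hqS, hp.trans hpq'.reachable⟩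
  have hT' : ∀ e ∈ E, ∀ p ∈ e, p ∈ T → ∀ q ∈ e, q ∈ T := by
    intro e he p hp hpT q hq
    rcases eq_or_ne p q with rfl | hne
    · exact hpT
    · rw [(Sym2.mem_and_mem_iff hne).1 ⟨hp, hq⟩] at he
      exact hT p q he hpT
  have hTS : T ⊆ S := Finset.filter_subset _ _
  have hxT : (x : V) ∈ T := Finset.mem_filter.2 ⟨x.2, x.2, .refl _⟩
  have hyT : (y : V) ∉ T := fun h ↦ hxy (Finset.mem_filter.1 h).2.2
  have hT0 : 0 < T.card := Finset.card_pos.2 ⟨x, hxT⟩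
  have hT1 : 0 < (S \ T).card := Finset.card_pos.2 ⟨y, Finset.mem_sdiff.2 ⟨y.2, hyT⟩⟩
  have hcard : (S \ T).card + T.card = S.card := Finset.card_sdiff_add_card_eq_card hTS
  have hsum : E.filter (fun e ↦ ∀ z ∈ e, z ∈ T) + E.filter (fun e ↦ ¬ ∀ z ∈ e, z ∈ T) = E :=
    Multiset.filter_add_not _ _
  have hev1 : EvenDegrees (E.filter fun e ↦ ∀ z ∈ e, z ∈ T) := by
    intro z
    by_cases hz : z ∈ T
    · have h0 : (E.filter fun e ↦ ¬ ∀ z ∈ e, z ∈ T).countP (fun e ↦ z ∈ e) = 0 := by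
        refine Multiset.countP_eq_zero.2 fun e he hze ↦ ?_
        obtain ⟨he, hne⟩ := Multiset.mem_filter.1 he
        exact hne (hT' e he z hze hz)
      have := hev z
      rwa [← hsum, Multiset.countP_add, h0, add_zero] at this
    · rw [Multiset.countP_eq_zero.2]
      · simp
      · intro e he hze
        exact hz ((Multiset.mem_filter.1 he).2 z hze)
  have hev2 : EvenDegrees (E.filter fun e ↦ ¬ ∀ z ∈ e, z ∈ T) :=
    EvenDegrees.of_add (by rwa [add_comm, hsum]) hev1
  have h1 := ih T.card (by omega) T (by omega) (hE.filter _)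
    (fun e he ↦ hd e (Multiset.mem_filter.1 he).1) (fun e he ↦ (Multiset.mem_filter.1 he).2)
    hev1 rfl
  have h2 := ih (S \ T).card (by omega) (S \ T) (by omega) (hE.filter _)
    (fun e he ↦ hd e (Multiset.mem_filter.1 he).1) (fun e he z hz ↦ by
      obtain ⟨he, hne⟩ := Multiset.mem_filter.1 he
      exact Finset.mem_sdiff.2 ⟨hES e he z hz, fun hzT ↦ hne (hT' e he z hz hzT)⟩) hev2 rfl
  exact ((h1.add h2).congr hsum).mono (by omega)

end Decompositions

section Star

variable {V : Type} {u v a b c d e : V}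

theorem evenDegrees_starEdges (hn : [u, v, a, b, c, d, e].Nodup) :
    EvenDegrees (starEdges u v a b c d e) := by
  have h := nodup_seven.1 hn
  have h1 := evenDegrees_triangle (a := u) (b := v) (c := a) (by tauto) (by tauto) (by tauto)
  have h2 := evenDegrees_square (a := u) (b := b) (c := v) (d := c) (by tauto) (by tauto)
    (by tauto) (by tauto) (by tauto) (by tauto)
  have h3 := evenDegrees_square (a := u) (b := d) (c := v) (d := e) (by tauto) (by tauto)
    (by tauto) (by tauto) (by tauto) (by tauto)
  convert (h1.add h2).add h3 using 1
  simp only [starEdges, Sym2.eq_swap]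
  abel

theorem mem_starEdges {f : Sym2 V} : f ∈ starEdges u v a b c d e ↔
    f = s(u, v) ∨ ∃ x ∈ [a, b, c, d, e], f = s(u, x) ∨ f = s(v, x) := by
  simp only [starEdges, Multiset.mem_add, Multiset.mem_singleton, List.mem_cons,
    List.not_mem_nil, or_false, exists_eq_or_imp, exists_eq_left]
  tauto

theorem starEdges_nodup (hn : [u, v, a, b, c, d, e].Nodup) :
    (starEdges u v a b c d e).Nodup := by
  have h := nodup_seven.1 hn
  simp only [starEdges, Multiset.singleton_add, Multiset.cons_add, Multiset.nodup_cons,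
    Multiset.mem_cons, Multiset.mem_singleton, Sym2.eq_iff, Multiset.nodup_singleton]
  clear hn
  grind

theorem Set.exists_five {s : Set V} (hs : s.ncard = 5) (ha : a ∈ s) (hb : b ∈ s) (hab : a ≠ b) :
    ∃ c d e, [a, b, c, d, e].Nodup ∧ ∀ x, x ∈ s ↔ x ∈ [a, b, c, d, e] := by
  have hfin : s.Finite := Set.finite_of_ncard_ne_zero (by omega)
  have h1 : (s \ {a}).ncard = 4 := by rw [Set.ncard_sdiff_singleton_of_mem ha, hs]
  have h2 : ((s \ {a}) \ {b}).ncard = 3 := by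
    rw [Set.ncard_sdiff_singleton_of_mem (show b ∈ s \ {a} from ⟨hb, hab.symm⟩), h1]
  obtain ⟨c, d, e, hcd, hce, hde, h⟩ := Set.ncard_eq_three.1 h2
  have h : ∀ x, (x ∈ s ∧ x ≠ a) ∧ x ≠ b ↔ x = c ∨ x = d ∨ x = e := fun x ↦ by
    simpa using Set.ext_iff.1 h x
  have hc := (h c).2 (by simp)
  have hd := (h d).2 (by simp)
  have he := (h e).2 (by simp)
  refine ⟨c, d, e, ?_, fun x ↦ ?_⟩
  · simp only [List.nodup_cons, List.mem_cons, not_or, List.not_mem_nil, List.nodup_nil,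
      not_false_eq_true, and_true]
    grind
  · simp only [List.mem_cons, List.not_mem_nil, or_false]
    grind

theorem Set.eq_or_mem_inter {s t : Set V} {w : V} (hs : s.ncard = 6) (hst : (s ∩ t).ncard = 5)
    (hws : w ∈ s) (hwt : w ∉ t) {x : V} (hx : x ∈ s) : x = w ∨ x ∈ s ∩ t := by
  have hfin : s.Finite := Set.finite_of_ncard_ne_zero (by omega)
  have hsub : insert w (s ∩ t) ⊆ s := Set.insert_subset hws Set.inter_subset_left
  have hcard : (insert w (s ∩ t)).ncard = 6 := by
    rw [Set.ncard_insert_of_notMem (fun h ↦ hwt h.2) (hfin.subset Set.inter_subset_left), hst]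
  have := Set.eq_of_subset_of_ncard_le hsub (by omega) hfin
  rw [← this] at hx
  exact hx

end Star

/-- In a minimum counterexample, if two adjacent degree-6 vertices `u` and `v` satisfy
`|N(u) ∩ N(v)| = 5`, then `N(u) ∩ N(v)` is an independent set. -/
theorem minCounterexample_common_five_independent {V : Type} [Fintype V]
    (G : SimpleGraph V) (hG : IsMinCounterexample G)
    (u v : V) (huv : G.Adj u v)
    (hdu : (G.neighborSet u).ncard = 6) (hdv : (G.neighborSet v).ncard = 6)
    (hcap : (G.neighborSet u ∩ G.neighborSet v).ncard = 5) :
    ∀ a ∈ G.neighborSet u ∩ G.neighborSet v,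
      ∀ b ∈ G.neighborSet u ∩ G.neighborSet v, ¬ G.Adj a b := by
  classical
  intro a ha b hb hab
  obtain ⟨c, d, e, hX, hmem⟩ := Set.exists_five hcap ha hb hab.ne
  have hu : ∀ x, G.Adj u x ↔ x = v ∨ x ∈ [a, b, c, d, e] := fun x ↦ by
    rw [← hmem]
    exact ⟨Set.eq_or_mem_inter hdu hcap huv (by simp), fun h ↦ h.elim (fun h ↦ h ▸ huv) (·.1)⟩
  have hv : ∀ x, G.Adj v x ↔ x = u ∨ x ∈ [a, b, c, d, e] := fun x ↦ by
    rw [← hmem, Set.inter_comm]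
    exact ⟨Set.eq_or_mem_inter hdv (Set.inter_comm _ _ ▸ hcap) huv.symm (by simp),
      fun h ↦ h.elim (fun h ↦ h ▸ huv.symm) (·.1)⟩
  have huX : u ∉ [a, b, c, d, e] := fun h ↦ G.loopless.irrefl u ((hu u).2 (.inr h))
  have hvX : v ∉ [a, b, c, d, e] := fun h ↦ G.loopless.irrefl v ((hv v).2 (.inr h))
  have hn : [u, v, a, b, c, d, e].Nodup :=
    List.nodup_cons.2 ⟨fun h ↦ (List.mem_cons.1 h).elim huv.ne huX, List.nodup_cons.2 ⟨hvX, hX⟩⟩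
  set E : Multiset (Sym2 V) := G.edgeFinset.val.filter fun f ↦ u ∉ f ∧ v ∉ f with hEdef
  have hE : ∀ f, f ∈ E ↔ f ∈ G.edgeSet ∧ u ∉ f ∧ v ∉ f := fun f ↦ by
    rw [hEdef, Multiset.mem_filter, Finset.mem_val, SimpleGraph.mem_edgeFinset]
  have hEnd : E.Nodup := G.edgeFinset.nodup.filter _
  have hnd : (starEdges u v a b c d e + E).Nodup := by
    refine Multiset.nodup_add.2 ⟨starEdges_nodup hn, hEnd, Multiset.disjoint_left.2 ?_⟩
    intro f hf hfE
    obtain ⟨-, h1, h2⟩ := (hE f).1 hfE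
    rcases mem_starEdges.1 hf with rfl | ⟨x, -, rfl | rfl⟩ <;> simp at h1 h2
  have hGE : ∀ f, f ∈ starEdges u v a b c d e + E ↔ f ∈ G.edgeSet := by
    intro f
    rw [Multiset.mem_add, hE, mem_starEdges]
    constructor
    · rintro ((rfl | ⟨x, hx, rfl | rfl⟩) | h)
      · exact huv
      · exact (hu x).2 (.inr hx)
      · exact (hv x).2 (.inr hx)
      · exact h.1
    · intro hf
      by_cases hfu : u ∈ f
      · obtain ⟨x, rfl⟩ := Sym2.mem_iff_exists.1 hfu
        rcases (hu x).1 hf with rfl | hx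
        · exact .inl (.inl rfl)
        · exact .inl (.inr ⟨x, hx, .inl rfl⟩)
      by_cases hfv : v ∈ f
      · obtain ⟨x, rfl⟩ := Sym2.mem_iff_exists.1 hfv
        rcases (hv x).1 hf with rfl | hx
        · simp at hfu
        · exact .inl (.inr ⟨x, hx, .inr rfl⟩)
      exact .inr ⟨hf, hfu, hfv⟩
  have hevG : EvenDegrees (starEdges u v a b c d e + E) := by
    intro x
    have := hG.1.1.2 x
    rw [ncard_neighborSet (f := id) Function.injective_id hnd x] at this
    · exact this
    · intro f
      rw [hGE]
      constructor
      · rintro ⟨hf, hx⟩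
        obtain ⟨y, rfl⟩ := Sym2.mem_iff_exists.1 hx
        exact ⟨y, hf, rfl⟩
      · rintro ⟨y, hy, rfl⟩
        exact ⟨hy, by simp⟩
  have hEoff : EvenOff u v E :=
    { nodup := hEnd
      notDiag := fun f hf ↦ G.not_isDiag_of_mem_edgeSet ((hE f).1 hf).1
      avoids_fst := fun f hf ↦ ((hE f).1 hf).2.1
      avoids_snd := fun f hf ↦ ((hE f).1 hf).2.2
      even := EvenDegrees.of_add (add_comm _ E ▸ hevG) (evenDegrees_starEdges hn) }
  have hbelow : HajosBelow (Fintype.card V) := fun W _ H hW hH ↦ by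
    by_contra hcon
    exact absurd (hG.2.1 W H ⟨hH, hcon⟩) (by omega)
  have hcard : 7 ≤ Fintype.card V := hn.length_le_card
  have hS : (Finset.univ \ {u, v}).card = Fintype.card V - 2 := by
    rw [Finset.card_sdiff_of_subset (Finset.subset_univ _), Finset.card_pair huv.ne,
      Finset.card_univ]
  have hdec : DecomposableOff u v ((Fintype.card V - 2 - 1) / 2) := by
    intro F hF hFd hFu hFv hFe
    rw [← hS]
    refine cycleDec_of_evenDegrees hbelow _ (by omega) hF hFd (fun f hf x hx ↦ ?_) hFe
    simp only [Finset.mem_sdiff, Finset.mem_univ, Finset.mem_insert, Finset.mem_singleton,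
      true_and, not_or]
    exact ⟨fun h ↦ hFu f hf (h ▸ hx), fun h ↦ hFv f hf (h ▸ hx)⟩
  have habE : s(a, b) ∈ E := by
    refine (hE _).2 ⟨hab, ?_, ?_⟩
    · simp only [Sym2.mem_iff]
      exact fun h ↦ huX (by rcases h with rfl | rfl <;> simp)
    · simp only [Sym2.mem_iff]
      exact fun h ↦ hvX (by rcases h with rfl | rfl <;> simp)
  exact hG.1.2 (((CycleDec.star_of_mem_edge hdec hEoff hn habE).mono (by omega)).fulfilsHajos
    hnd hGE)
end

section
/- Let G be an Eulerian graph on n vertices that contains a vertex ṽ of degree n−2 or n−1. If G fulfils Hajós' conjecture, then there exists a partition of the edge set of G into at most ⌊(n−1)/2⌋ edge-disjoint cycles such that every cycle of the partition passes through ṽ. -/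
open SimpleGraph in
/-- A cycle contains at most two edges at each vertex. -/
theorem SimpleGraph.Walk.IsCycle.ncard_setOf_mem_edges_le_two {V : Type*} {G : SimpleGraph V}
    {u : V} {p : G.Walk u u} (hp : p.IsCycle) (v : V) :
    {w | s(v, w) ∈ p.edges}.ncard ≤ 2 := by
  by_cases hv : v ∈ p.support
  · rw [← hp.ncard_neighborSet_toSubgraph_eq_two hv]
    refine le_of_eq (congrArg Set.ncard ?_)
    ext w
    simp [Subgraph.mem_neighborSet, ← Subgraph.mem_edgeSet]
  · have : {w | s(v, w) ∈ p.edges} = ∅ :=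
      Set.eq_empty_of_forall_notMem fun w hw => hv (p.fst_mem_support_of_mem_edges hw)
    simp [this]

/-- If an Eulerian graph `G` on `n` vertices has a vertex `ṽ` of degree `n-2` or `n-1`
and fulfils Hajós' conjecture, then it has a partition of its edge set into at most
`⌊(n-1)/2⌋` edge-disjoint cycles all of which pass through `ṽ`. -/
theorem hajos_high_degree_through_vertex {V : Type} [Fintype V]
    (G : SimpleGraph V) (hG : IsEulerian G) (vt : V)
    (hdeg : (G.neighborSet vt).ncard = Fintype.card V - 2 ∨
            (G.neighborSet vt).ncard = Fintype.card V - 1)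
    (hH : FulfilsHajos G) :
    ∃ (m : ℕ) (c : (i : Fin m) → G.Walk vt vt),
      m ≤ (Fintype.card V - 1) / 2 ∧
      (∀ i, (c i).IsCycle) ∧
      (∀ i j, i ≠ j → ∀ e, e ∈ (c i).edges → e ∉ (c j).edges) ∧
      (∀ e, e ∈ G.edgeSet ↔ ∃ i, e ∈ (c i).edges) := by
  classical
  obtain ⟨m, B, c, hm, hc, hd, he⟩ := hH
  let S : Finset (Fin m) := Finset.univ.filter fun i => vt ∈ (c i).support
  have hsub : G.neighborSet vt = ⋃ i ∈ S, {w | s(vt, w) ∈ (c i).edges} := by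
    ext w
    simp only [SimpleGraph.mem_neighborSet, ← SimpleGraph.mem_edgeSet, he, S, Set.mem_iUnion,
      Finset.mem_filter, Finset.mem_univ, true_and, Set.mem_ofPred_eq, exists_prop]
    exact exists_congr fun i =>
      ⟨fun h => ⟨(c i).fst_mem_support_of_mem_edges h, h⟩, fun h => h.2⟩
  have hle : (G.neighborSet vt).ncard ≤ 2 * S.card := by
    rw [hsub]
    calc _ ≤ ∑ i ∈ S, {w | s(vt, w) ∈ (c i).edges}.ncard := Finset.set_ncard_biUnion_le _ _
      _ ≤ ∑ _i ∈ S, 2 := Finset.sum_le_sum fun i _ => (hc i).ncard_setOf_mem_edges_le_two vt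
      _ = 2 * S.card := by simp [mul_comm]
  have hS : S = Finset.univ := by
    refine Finset.eq_univ_of_card _ (le_antisymm (Finset.card_le_univ _) ?_)
    obtain ⟨k, hk⟩ := hG.2 vt
    rw [Fintype.card_fin]
    omega
  have hv (i : Fin m) : vt ∈ (c i).support := by
    have hi : i ∈ S := hS ▸ Finset.mem_univ i
    simpa [S] using hi
  have hmem (i : Fin m) (e : Sym2 V) : e ∈ ((c i).rotate vt (hv i)).edges ↔ e ∈ (c i).edges :=
    ((c i).rotate_edges vt (hv i)).mem_iff
  refine ⟨m, fun i => (c i).rotate vt (hv i), hm, fun i => (hc i).rotate (hv i), ?_, ?_⟩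
  · simpa only [hmem] using hd
  · simpa only [hmem] using he
end

section
/- Let G be an Eulerian graph on n vertices containing a vertex ṽ of degree n−2 or n−1, and let I = {1, …, ⌊(n−1)/2⌋}. Suppose edge sets (C_i)_{i∈I} partition E(G) (allowing empty sets) such that for every i ∈ I: the subgraph with edge set C_i is 2-regular on its support or empty, ṽ is incident to C_i whenever C_i is nonempty, and for every subset S ⊆ V(G) \ {ṽ}, n · |{e ∈ C_i : e has an endpoint in S}| ≥ (n+1) · |{v ∈ S : v is incident to an edge of C_i}|. Then each nonempty C_i is the edge set of a single cycle through ṽ, so G fulfils Hajós' conjecture. -/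
namespace SimpleGraph

variable {V : Type*} {G : SimpleGraph V}

lemma ncard_neighborSet_eq_ncard_incidenceSet (G : SimpleGraph V) (v : V) :
    (G.neighborSet v).ncard = (G.incidenceSet v).ncard := by
  classical
  simpa only [Set.ncard_def, Set.encard, ENat.card] using
    congrArg ENat.toNat (ENat.card_congr (G.incidenceSetEquivNeighborSet v)).symm

/-- In a disjoint union of cycles, a union of cycles has as many edges as vertices. -/
lemma IsCycles.ncard_setOf_edge_meets [Finite V] (h : G.IsCycles) {S : Set V}
    (hS : ∀ w ∈ S, (G.neighborSet w).Nonempty) (hclosed : ∀ w ∈ S, ∀ x, G.Adj w x → x ∈ S) :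
    {e ∈ G.edgeSet | ∃ w ∈ S, w ∈ e}.ncard = S.ncard := by
  classical
  have := Fintype.ofFinite V
  have key := Finset.card_mul_eq_card_mul (s := S.toFinset)
    (t := {e ∈ G.edgeSet | ∃ w ∈ S, w ∈ e}.toFinset) (m := 2) (n := 2)
    (fun (w : V) (e : Sym2 V) => w ∈ e) ?_ ?_
  · rw [Set.ncard_eq_toFinset_card', Set.ncard_eq_toFinset_card']
    omega
  · intro w hw
    rw [Set.mem_toFinset] at hw
    rw [← h (hS w hw), ncard_neighborSet_eq_ncard_incidenceSet, Set.ncard_eq_toFinset_card']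
    congr 1
    ext e
    simp only [Finset.mem_bipartiteAbove, Set.mem_toFinset]
    exact ⟨fun he => ⟨he.1.1, he.2⟩, fun he => ⟨⟨he.1, w, hw, he.2⟩, he.2⟩⟩
  · intro e he
    rw [Set.mem_toFinset] at he
    obtain ⟨heG, w, hw, hwe⟩ := he
    obtain ⟨x, rfl⟩ := hwe
    have hadj : G.Adj w x := heG
    have hx := hclosed w hw x hadj
    rw [← Finset.card_pair hadj.ne]
    congr 1
    ext y
    simp only [Finset.mem_bipartiteBelow, Set.mem_toFinset, Sym2.mem_iff, Finset.mem_insert,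
      Finset.mem_singleton]
    exact ⟨And.right, fun hy => ⟨by rcases hy with rfl | rfl <;> assumption, hy⟩⟩

/-- A disjoint union of cycles all of whose edges are reachable from `v` is a single cycle. -/
lemma IsCycles.exists_isCycle_edges_eq_edgeSet [Finite V] (h : G.IsCycles) {v : V}
    (hv : (G.neighborSet v).Nonempty) (hreach : ∀ a b, G.Adj a b → G.Reachable v a) :
    ∃ p : G.Walk v v, p.IsCycle ∧ {e | e ∈ p.edges} = G.edgeSet := by
  classical
  have := Fintype.ofFinite V
  obtain ⟨p, hp, hverts⟩ := h.exists_cycle_toSubgraph_verts_eq_connectedComponentSupp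
    (c := G.connectedComponentMk v) rfl hv
  refine ⟨p, hp, Set.ext fun e => ⟨fun he => p.edges_subset_edgeSet he, ?_⟩⟩
  induction e with | _ a b
  intro hab
  have ha : a ∈ p.toSubgraph.verts := by
    rw [hverts]
    exact ConnectedComponent.sound (hreach a b hab).symm
  exact Walk.adj_toSubgraph_iff_mem_edges.mp ((hp.adj_toSubgraph_iff_of_isCycles h ha b).mpr hab)

/-- An edge set that is 2-regular on its support, contains an edge at `v`, and in which every
nonempty set of support vertices avoiding `v` meets strictly more edges than it has vertices,
is a single cycle through `v`. -/
lemma exists_isCycle_of_two_regular_of_cut [Finite V] {C : Set (Sym2 V)} (hC : C ⊆ G.edgeSet)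
    (hreg : ∀ w : V, (∃ e ∈ C, w ∈ e) → {e ∈ C | w ∈ e}.ncard = 2) {v : V}
    (hv : ∃ e ∈ C, v ∈ e)
    (hcut : ∀ S : Set V, v ∉ S → S.Nonempty → (∀ w ∈ S, ∃ e ∈ C, w ∈ e) →
      S.ncard < {e ∈ C | ∃ w ∈ S, w ∈ e}.ncard) :
    ∃ p : G.Walk v v, p.IsCycle ∧ {e | e ∈ p.edges} = C := by
  obtain ⟨H, hHG, rfl⟩ : ∃ H ≤ G, H.edgeSet = C := by
    have hedge : (fromEdgeSet C).edgeSet = C := by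
      rw [edgeSet_fromEdgeSet, sdiff_eq_left, Set.disjoint_left]
      exact fun e he => G.not_isDiag_of_mem_edgeSet (hC he)
    exact ⟨fromEdgeSet C, by rwa [← edgeSet_subset_edgeSet, hedge], hedge⟩
  have hnbr : ∀ w, (∃ e ∈ H.edgeSet, w ∈ e) ↔ (H.neighborSet w).Nonempty := by
    refine fun w => ⟨?_, fun ⟨x, hx⟩ => ⟨s(w, x), hx, Sym2.mem_mk_left w x⟩⟩
    rintro ⟨_, he, x, rfl⟩
    exact ⟨x, he⟩
  have hcyc : H.IsCycles := fun w hw => by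
    rw [ncard_neighborSet_eq_ncard_incidenceSet]
    exact hreg w ((hnbr w).mpr hw)
  have hreach : ∀ a b, H.Adj a b → H.Reachable v a := by
    intro a b hab
    by_contra hva
    let S := {w | ¬ H.Reachable v w ∧ (H.neighborSet w).Nonempty}
    have hlt := hcut S (fun hvS => hvS.1 (Reachable.refl v)) ⟨a, hva, b, hab⟩
      (fun w hw => (hnbr w).mpr hw.2)
    have heq := hcyc.ncard_setOf_edge_meets (S := S) (fun w hw => hw.2) fun w hw x hwx =>
      ⟨fun hvx => hw.1 (hvx.trans hwx.symm.reachable), w, hwx.symm⟩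
    exact hlt.ne' heq
  obtain ⟨p, hp, hedges⟩ := hcyc.exists_isCycle_edges_eq_edgeSet ((hnbr v).mp hv) hreach
  exact ⟨p.mapLe hHG, hp.mapLe hHG, by rw [Walk.edges_mapLe_eq_edges, hedges]⟩

end SimpleGraph

/-- Correctness of the IP-formulation for graphs with a high-degree vertex:
if edge sets `C i`, `i ∈ {1, …, ⌊(n-1)/2⌋}`, partition the edge set (empty sets
allowed), each `C i` is 2-regular on its support, `ṽ` is incident to every nonempty
`C i`, and the cut inequalities hold for every `S ⊆ V \ {ṽ}`, then every nonempty
`C i` is the edge set of a single cycle through `ṽ`, and `G` fulfils Hajós'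
conjecture. -/
theorem ip_high_degree_correct {V : Type} [Fintype V]
    (G : SimpleGraph V) (hG : IsEulerian G) (vt : V)
    (hdeg : (G.neighborSet vt).ncard = Fintype.card V - 2 ∨
            (G.neighborSet vt).ncard = Fintype.card V - 1)
    (C : Fin ((Fintype.card V - 1) / 2) → Set (Sym2 V))
    (hsub : ∀ i, C i ⊆ G.edgeSet)
    (hpart : ∀ e ∈ G.edgeSet, ∃! i, e ∈ C i)
    (hreg : ∀ i, ∀ w : V, (∃ e ∈ C i, w ∈ e) → ({e ∈ C i | w ∈ e}).ncard = 2)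
    (hvt : ∀ i, (C i).Nonempty → ∃ e ∈ C i, vt ∈ e)
    (hcut : ∀ i, ∀ S : Set V, vt ∉ S →
      (Fintype.card V + 1) * ({w ∈ S | ∃ e ∈ C i, w ∈ e}).ncard ≤
        Fintype.card V * ({e ∈ C i | ∃ w ∈ S, w ∈ e}).ncard) :
    (∀ i, (C i).Nonempty →
      ∃ w : G.Walk vt vt, w.IsCycle ∧ {e | e ∈ w.edges} = C i) ∧
    FulfilsHajos G := by
  have hcycle : ∀ i, (C i).Nonempty →
      ∃ w : G.Walk vt vt, w.IsCycle ∧ {e | e ∈ w.edges} = C i := by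
    refine fun i hi => SimpleGraph.exists_isCycle_of_two_regular_of_cut (hsub i) (hreg i)
      (hvt i hi) fun S hvS hS hSC => ?_
    have hle := hcut i S hvS
    rw [Set.sep_eq_self_iff_mem_true.mpr hSC] at hle
    have hpos : 0 < S.ncard := (Set.ncard_pos S.toFinite).mpr hS
    by_contra! hcon
    have := Nat.mul_le_mul_left (Fintype.card V) hcon
    rw [add_mul] at hle
    omega
  refine ⟨hcycle, ?_⟩
  classical
  let ι := {i // (C i).Nonempty}
  choose c hc hedges using hcycle
  let f := (Fintype.equivFin ι).symm
  have hmem : ∀ j e, e ∈ (c (f j).1 (f j).2).edges ↔ e ∈ C (f j) := fun j e =>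
    Set.ext_iff.mp (hedges (f j).1 (f j).2) e
  refine ⟨Fintype.card ι, fun _ => vt, fun j => c (f j).1 (f j).2, ?_, fun j => hc _ _, ?_, ?_⟩
  · simpa using Fintype.card_subtype_le fun i => (C i).Nonempty
  · intro j k hjk e hej hek
    rw [hmem] at hej hek
    exact hjk (f.injective (Subtype.ext ((hpart e (hsub _ hej)).unique hej hek)))
  · intro e
    simp only [hmem]
    refine ⟨fun he => ?_, fun ⟨j, hj⟩ => hsub _ hj⟩
    obtain ⟨i, hi, -⟩ := hpart e he
    exact ⟨f.symm ⟨i, e, hi⟩, by simpa using hi⟩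
end
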